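/- Let s ∈ (0,1), let η ∈ C^∞(ℝ^n) ∩ W^{2,∞}(ℝ^n), and assume that u ∈ W^{1,∞}(ℝ^n) is a weak solution of (-Δ)^s u = 0 in B₁. Then there exists σ₀ > 0, depending only on n and ‖η‖_{C²(ℝ^n)}, such that for every σ ≥ σ₀, (-Δ)^s( η² |∇u|² + σ u² ) ≤ 0 everywhere in B₁. -/

import Mathlib

open MeasureTheory Filter Metric Set

noncomputable section

/-- Euclidean space `ℝⁿ`. -/
abbrev En (n : ℕ) := EuclideanSpace ℝ (Fin n)

/-- Principal value integral centered at `x`: the limit, as `ε → 0⁺`, of the integrals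
over the complement of the `ε`-ball centered at `x`. -/
def pvAt (n : ℕ) (x : En n) (g : En n → ℝ) : ℝ :=
  limUnder (nhdsWithin (0:ℝ) (Set.Ioi 0))
    (fun ε => ∫ y in {y : En n | ε ≤ dist y x}, g y)

/-- Integro-differential operator with kernel `K`:
`𝓛_K u (x) = P.V. ∫ (u x - u y) K (x - y) dy`. -/
def opK (n : ℕ) (K : En n → ℝ) (u : En n → ℝ) (x : En n) : ℝ :=
  pvAt n x (fun y => (u x - u y) * K (x - y))

/-- The normalizing constant `c_{n,s}` of the fractional Laplacian, for which the
Fourier symbol is `|ξ|^{2s}`. -/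
def cns (n : ℕ) (s : ℝ) : ℝ :=
  (4:ℝ) ^ s * s * Real.Gamma ((n:ℝ)/2 + s) / (Real.pi ^ ((n:ℝ)/2) * Real.Gamma (1 - s))

/-- The fractional Laplacian `(-Δ)^s`, for `s ∈ (0,1)`. -/
def fracLap (n : ℕ) (s : ℝ) (u : En n → ℝ) (x : En n) : ℝ :=
  opK n (fun z => cns n s * ‖z‖ ^ (-((n:ℝ) + 2*s))) u x

/-- Directional derivative `∂_e u`. -/
def dd (n : ℕ) (e : En n) (u : En n → ℝ) (x : En n) : ℝ := fderiv ℝ u x e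

/-- Second directional derivative `∂²_e u`. -/
def dd2 (n : ℕ) (e : En n) (u : En n → ℝ) (x : En n) : ℝ := fderiv ℝ (dd n e u) x e

/-- `‖η‖_{C²(ℝⁿ)} ≤ M`. -/
def C2BddBy (n : ℕ) (η : En n → ℝ) (M : ℝ) : Prop :=
  ∀ x : En n, |η x| ≤ M ∧ ‖fderiv ℝ η x‖ ≤ M ∧ ‖fderiv ℝ (fderiv ℝ η) x‖ ≤ M

/-- The kernel `K` is even and has two-sided power bounds with constants `C₁ ≤ C₂`:
`K(z) = K(-z)` and `C₁ s(1-s)|z|^{-n-2s} ≤ K(z) ≤ C₂ s(1-s)|z|^{-n-2s}` for `z ≠ 0`. -/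
def evenPowKernel (n : ℕ) (s C₁ C₂ : ℝ) (K : En n → ℝ) : Prop :=
  (∀ z : En n, z ≠ 0 → K z = K (-z)) ∧
  (∀ z : En n, z ≠ 0 →
    C₁ * (s * (1 - s)) * ‖z‖ ^ (-((n:ℝ) + 2*s)) ≤ K z ∧
    K z ≤ C₂ * (s * (1 - s)) * ‖z‖ ^ (-((n:ℝ) + 2*s)))

/-- `K ∈ C²(ℝⁿ \ {0})` with `|z||∇K(z)| + |z|²|D²K(z)| ≤ C₃ K(z)` for `z ≠ 0`. -/
def kernelDerivBdd (n : ℕ) (C₃ : ℝ) (K : En n → ℝ) : Prop :=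
  ContDiffOn ℝ 2 K {z : En n | z ≠ 0} ∧
  ∀ z : En n, z ≠ 0 →
    ‖z‖ * ‖fderiv ℝ K z‖ + ‖z‖^2 * ‖fderiv ℝ (fderiv ℝ K) z‖ ≤ C₃ * K z

open scoped NNReal

/-- `u` is a weak (variational) solution of `(-Δ)^s u = 0` in `B₁`:
`∬ (u(x)−u(y))(φ(x)−φ(y)) |x−y|^{−n−2s} dx dy = 0` for every `φ ∈ C_c^∞(B₁)`. -/
def IsWeakSHarmonicInB1 (n : ℕ) (s : ℝ) (u : En n → ℝ) : Prop :=
  ∀ φ : En n → ℝ, ContDiff ℝ (⊤ : ℕ∞) φ → HasCompactSupport φ →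
    tsupport φ ⊆ ball (0 : En n) 1 →
    (∫ p : En n × En n,
        (u p.1 - u p.2) * (φ p.1 - φ p.2) * ‖p.1 - p.2‖ ^ (-((n:ℝ) + 2*s))) = 0

namespace FracBernstein

variable {n : ℕ}

/-- Unnormalized radial profile supported in the unit ball. -/
def profile (n : ℕ) (z : En n) : ℝ := Real.smoothTransition (1 - ‖z‖ ^ 2)

lemma profile_contDiff : ContDiff ℝ (⊤ : ℕ∞) (profile n) :=
  Real.smoothTransition.contDiff.comp (contDiff_const.sub (contDiff_norm_sq ℝ))

lemma profile_eq_zero {z : En n} (hz : 1 ≤ ‖z‖) : profile n z = 0 :=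
  Real.smoothTransition.zero_of_nonpos (by nlinarith)

lemma profile_hasCompactSupport : HasCompactSupport (profile n) := by
  refine HasCompactSupport.intro (isCompact_closedBall (0 : En n) 1) fun z hz => ?_
  exact profile_eq_zero (by simpa using (not_le.1 (by simpa using hz)).le)

lemma profile_sq_integral_pos : 0 < ∫ z, profile n z ^ 2 := by
  have hc : Continuous fun z => profile n z ^ 2 := profile_contDiff.continuous.pow 2
  refine hc.integral_pos_of_hasCompactSupport_nonneg_nonzero ?_ (fun z => sq_nonneg _) (x := 0) ?_
  · exact profile_hasCompactSupport.comp_left (g := fun t : ℝ => t ^ 2) (by simp)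
  · simp [profile, Real.smoothTransition.one_of_one_le]

/-- The square root of the averaging density. -/
def rootDensity (n : ℕ) (z : En n) : ℝ := (Real.sqrt (∫ z, profile n z ^ 2))⁻¹ * profile n z

/-- A smooth radial probability density supported in the unit ball. -/
def density (n : ℕ) (z : En n) : ℝ := rootDensity n z ^ 2

lemma rootDensity_contDiff : ContDiff ℝ (⊤ : ℕ∞) (rootDensity n) :=
  contDiff_const.mul profile_contDiff

lemma rootDensity_hasCompactSupport : HasCompactSupport (rootDensity n) :=
  profile_hasCompactSupport.mul_left

lemma density_contDiff : ContDiff ℝ (⊤ : ℕ∞) (density n) := rootDensity_contDiff.pow 2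

lemma density_continuous : Continuous (density n) := density_contDiff.continuous

lemma density_hasCompactSupport : HasCompactSupport (density n) :=
  rootDensity_hasCompactSupport.comp_left (g := fun t : ℝ => t ^ 2) (by simp)

lemma density_nonneg (z : En n) : 0 ≤ density n z := sq_nonneg _

lemma density_eq_zero {z : En n} (hz : 1 ≤ ‖z‖) : density n z = 0 := by
  simp [density, rootDensity, profile_eq_zero hz]

lemma density_congr {z w : En n} (h : ‖z‖ = ‖w‖) : density n z = density n w := by
  simp [density, rootDensity, profile, h]

lemma density_zero_pos : 0 < density n 0 := by
  have h := profile_sq_integral_pos (n := n)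
  have : 0 < rootDensity n 0 := by
    simp only [rootDensity, profile]
    rw [Real.smoothTransition.one_of_one_le (by simp)]
    have := Real.sqrt_pos.2 h
    positivity
  exact pow_pos this 2

lemma density_integrable : Integrable (density n) :=
  density_continuous.integrable_of_hasCompactSupport density_hasCompactSupport

lemma density_integral : ∫ z, density n z = 1 := by
  have h := profile_sq_integral_pos (n := n)
  simp only [density, rootDensity, mul_pow]
  rw [integral_const_mul, inv_pow, Real.sq_sqrt h.le, inv_mul_cancel₀ h.ne']

/-- Averaging at scale `r` against the density. -/
def avg (r : ℝ) (f : En n → ℝ) (x : En n) : ℝ := ∫ z, density n z * f (x + r • z)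

/-- Measurable and bounded functions. -/
def BddMeas (f : En n → ℝ) : Prop := Measurable f ∧ ∃ B, ∀ x, |f x| ≤ B

namespace BddMeas

lemma const (c : ℝ) : BddMeas (fun _ : En n => c) := ⟨measurable_const, |c|, fun _ => le_rfl⟩

lemma mul {f g : En n → ℝ} (hf : BddMeas f) (hg : BddMeas g) : BddMeas fun x => f x * g x := by
  obtain ⟨hf, A, hA⟩ := hf
  obtain ⟨hg, B, hB⟩ := hg
  refine ⟨hf.mul hg, A * B, fun x => ?_⟩
  rw [abs_mul]
  exact mul_le_mul (hA x) (hB x) (abs_nonneg _) ((abs_nonneg _).trans (hA x))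

lemma sq {f : En n → ℝ} (hf : BddMeas f) : BddMeas fun x => f x ^ 2 := by
  simpa only [pow_two] using hf.mul hf

lemma add {f g : En n → ℝ} (hf : BddMeas f) (hg : BddMeas g) : BddMeas fun x => f x + g x := by
  obtain ⟨hf, A, hA⟩ := hf
  obtain ⟨hg, B, hB⟩ := hg
  exact ⟨hf.add hg, A + B, fun x => (abs_add_le _ _).trans (add_le_add (hA x) (hB x))⟩

lemma sub {f g : En n → ℝ} (hf : BddMeas f) (hg : BddMeas g) : BddMeas fun x => f x - g x := by
  obtain ⟨hf, A, hA⟩ := hf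
  obtain ⟨hg, B, hB⟩ := hg
  exact ⟨hf.sub hg, A + B, fun x => (abs_sub _ _).trans (add_le_add (hA x) (hB x))⟩

lemma comp {f : En n → ℝ} (hf : BddMeas f) {g : En n → En n} (hg : Measurable g) :
    BddMeas fun x => f (g x) := by
  obtain ⟨hf, A, hA⟩ := hf
  exact ⟨hf.comp hg, A, fun x => hA _⟩

lemma comp_affine {f : En n → ℝ} (hf : BddMeas f) (x : En n) (r : ℝ) :
    BddMeas fun z => f (x + r • z) := hf.comp (by fun_prop)

lemma integrable_mul {f : En n → ℝ} (hf : BddMeas f) {φ : En n → ℝ} (hφ : Integrable φ) :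
    Integrable fun x => φ x * f x := by
  obtain ⟨hf, A, hA⟩ := hf
  exact hφ.mul_bdd (c := A) hf.aestronglyMeasurable (Eventually.of_forall hA)

lemma abs_integral_mul_le {f : En n → ℝ} {B : ℝ} (hB : ∀ x, |f x| ≤ B)
    {φ : En n → ℝ} (hφ : Integrable φ) : |∫ x, φ x * f x| ≤ (∫ x, |φ x|) * B := by
  rw [← integral_mul_const]
  rw [← Real.norm_eq_abs]
  refine norm_integral_le_of_norm_le (f := fun x => φ x * f x) (hφ.abs.mul_const B)
    (Eventually.of_forall fun x => ?_)
  rw [Real.norm_eq_abs, abs_mul]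
  exact mul_le_mul_of_nonneg_left (hB x) (abs_nonneg _)

end BddMeas

lemma cauchy_schwarz_integral {f g : En n → ℝ} (hf : Integrable fun z => f z ^ 2)
    (hg : Integrable fun z => g z ^ 2) (hfg : Integrable fun z => f z * g z) :
    (∫ z, f z * g z) ^ 2 ≤ (∫ z, f z ^ 2) * ∫ z, g z ^ 2 := by
  have key : ∀ t : ℝ, 0 ≤ (∫ z, g z ^ 2) * (t * t) + (2 * ∫ z, f z * g z) * t + ∫ z, f z ^ 2 := by
    intro t
    have h : (∫ z, (f z + t * g z) ^ 2) =
        (∫ z, g z ^ 2) * (t * t) + (2 * ∫ z, f z * g z) * t + ∫ z, f z ^ 2 := by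
      have : ∀ z, (f z + t * g z) ^ 2 = (t * t) * g z ^ 2 + (2 * t) * (f z * g z) + f z ^ 2 := by
        intro z; ring
      simp_rw [this]
      have h1 : Integrable fun z => (t * t) * g z ^ 2 := hg.const_mul _
      have h2 : Integrable fun z => (2 * t) * (f z * g z) := hfg.const_mul _
      have h3 : Integrable fun z => (t * t) * g z ^ 2 + (2 * t) * (f z * g z) := h1.add h2
      rw [integral_add h3 hf, integral_add h1 h2, integral_const_mul, integral_const_mul]
      ring
    rw [← h]
    exact integral_nonneg fun z => sq_nonneg _
  have := discrim_le_zero key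
  simp only [discrim] at this
  nlinarith

/-- Energy of the root of the density. -/
def rootEnergy (n : ℕ) : ℝ := ∫ z, ‖fderiv ℝ (rootDensity n) z‖ ^ 2

lemma rootEnergy_nonneg : 0 ≤ rootEnergy n := integral_nonneg fun _ => sq_nonneg _

lemma fderiv_rootDensity_continuous : Continuous (fderiv ℝ (rootDensity n)) :=
  rootDensity_contDiff.continuous_fderiv (by simp)

lemma integral_dirDeriv_rootDensity_sq_le {e : En n} (he : ‖e‖ ≤ 1) :
    Integrable (fun z => (fderiv ℝ (rootDensity n) z e) ^ 2) ∧
      ∫ z, (fderiv ℝ (rootDensity n) z e) ^ 2 ≤ rootEnergy n := by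
  have hs : HasCompactSupport (fderiv ℝ (rootDensity n)) :=
    rootDensity_hasCompactSupport.fderiv (𝕜 := ℝ)
  have hc1 : Continuous fun z => ‖fderiv ℝ (rootDensity n) z‖ ^ 2 :=
    fderiv_rootDensity_continuous.norm.pow 2
  have hs1 : HasCompactSupport fun z => ‖fderiv ℝ (rootDensity n) z‖ ^ 2 :=
    hs.comp_left (g := fun t : En n →L[ℝ] ℝ => ‖t‖ ^ 2) (by simp)
  have hc2 : Continuous fun z => fderiv ℝ (rootDensity n) z e :=
    fderiv_rootDensity_continuous.clm_apply continuous_const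
  have hs2 : HasCompactSupport fun z => (fderiv ℝ (rootDensity n) z e) ^ 2 :=
    hs.comp_left (g := fun t : En n →L[ℝ] ℝ => (t e) ^ 2) (by simp)
  have h2 : ∀ z, (fderiv ℝ (rootDensity n) z e) ^ 2 ≤ ‖fderiv ℝ (rootDensity n) z‖ ^ 2 := by
    intro z
    have h : |fderiv ℝ (rootDensity n) z e| ≤ ‖fderiv ℝ (rootDensity n) z‖ := by
      have := (fderiv ℝ (rootDensity n) z).le_opNorm e
      rw [Real.norm_eq_abs] at this
      exact this.trans (mul_le_of_le_one_right (norm_nonneg _) he)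
    exact sq_le_sq' (by linarith [neg_abs_le (fderiv ℝ (rootDensity n) z e)])
      ((le_abs_self _).trans h)
  have h1 := hc1.integrable_of_hasCompactSupport (μ := volume) hs1
  have h3 := (hc2.pow 2).integrable_of_hasCompactSupport (μ := volume) hs2
  exact ⟨h3, integral_mono h3 h1 h2⟩

/-- Integration by parts for Lipschitz functions at scale `r`. -/
lemma integral_mul_fderiv_affine {u : En n → ℝ} {L : ℝ≥0} (hu : LipschitzWith L u)
    {ψ : En n → ℝ} (hψ : ContDiff ℝ 1 ψ) (hψs : HasCompactSupport ψ) (x e : En n) {r : ℝ} :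
    ∫ z, ψ z * (r * fderiv ℝ u (x + r • z) e) = -∫ z, fderiv ℝ ψ z e * u (x + r • z) := by
  obtain ⟨D, hD⟩ := hψ.lipschitzWith_of_hasCompactSupport hψs (by simp)
  have hf : LipschitzWith (L * ‖r‖₊) fun z => u (x + r • z) := by
    refine hu.comp (LipschitzWith.of_dist_le_mul fun a b => ?_)
    rw [dist_add_left, dist_smul₀, coe_nnnorm]
  have h := LipschitzWith.integral_lineDeriv_mul_eq (μ := volume) hf hD hψs e
  have h1 : ∫ z, ψ z * (r * fderiv ℝ u (x + r • z) e) =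
      ∫ z, lineDeriv ℝ (fun z => u (x + r • z)) z e * ψ z := by
    refine integral_congr_ae ?_
    filter_upwards [hf.ae_differentiableAt (μ := volume)] with z hz
    rw [hz.lineDeriv_eq_fderiv]
    have e1 : fderiv ℝ (fun z => u (x + r • z)) z = r • fderiv ℝ u (x + r • z) := by
      have := fderiv_comp_smul (𝕜 := ℝ) (f := fun y => u (x + y)) (x := z) r
      simp only [fderiv_comp_add_left] at this
      exact this
    rw [e1]
    simp [mul_comm]
  rw [h1, h, ← integral_neg]
  refine integral_congr_ae (Eventually.of_forall fun z => ?_)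
  simp only
  rw [((hψ.differentiable (by simp)) z).lineDeriv_eq_fderiv]
  simp

lemma fderiv_rootDensity_eq_zero {z : En n} (hz : 1 < ‖z‖) : fderiv ℝ (rootDensity n) z = 0 := by
  have h : rootDensity n =ᶠ[nhds z] fun _ => 0 := by
    filter_upwards [continuous_norm.continuousAt.eventually (lt_mem_nhds hz)] with y hy
    simp [rootDensity, profile_eq_zero (le_of_lt hy)]
  rw [h.fderiv_eq]
  simp

lemma bddMeas_of_hasCompactSupport {f : En n → ℝ} (hf : Continuous f) (hs : HasCompactSupport f) :
    BddMeas f := by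
  obtain ⟨C, hC⟩ := hs.exists_bound_of_continuous hf
  exact ⟨hf.measurable, C, hC⟩

lemma integral_density_mul_sub_sq {U : En n → ℝ} (hU : BddMeas U) :
    ∫ z, density n z * (U z - ∫ y, density n y * U y) ^ 2 =
      (∫ z, density n z * U z ^ 2) - (∫ z, density n z * U z) ^ 2 := by
  set m := ∫ y, density n y * U y with hm
  have h1 : Integrable fun z => density n z * U z ^ 2 := hU.sq.integrable_mul density_integrable
  have h2 : Integrable fun z => (2 * m) * (density n z * U z) :=
    (hU.integrable_mul density_integrable).const_mul _
  have h3 : Integrable fun z => m ^ 2 * density n z := density_integrable.const_mul _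
  have h4 : Integrable fun z => density n z * U z ^ 2 - (2 * m) * (density n z * U z) := h1.sub h2
  have : ∀ z, density n z * (U z - m) ^ 2 =
      density n z * U z ^ 2 - (2 * m) * (density n z * U z) + m ^ 2 * density n z := by
    intro z; ring
  simp_rw [this]
  rw [integral_add h4 h3, integral_sub h1 h2, integral_const_mul, integral_const_mul, ← hm,
    density_integral]
  ring

lemma jensen_density {U : En n → ℝ} (hU : BddMeas U) :
    (∫ z, density n z * U z) ^ 2 ≤ ∫ z, density n z * U z ^ 2 := by
  have := integral_density_mul_sub_sq hU
  have h : 0 ≤ ∫ z, density n z * (U z - ∫ y, density n y * U y) ^ 2 :=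
    integral_nonneg fun z => mul_nonneg (density_nonneg z) (sq_nonneg _)
  linarith

lemma sq_integral_weighted_le {U V ζ : En n → ℝ} {e : En n} {a b : ℝ} (hU : BddMeas U)
    (he : ‖e‖ ≤ 1)
    (hibp : ∀ ψ : En n → ℝ, ContDiff ℝ 1 ψ → HasCompactSupport ψ →
      ∫ z, ψ z * V z = -∫ z, fderiv ℝ ψ z e * U z)
    (hζ : ContDiff ℝ 1 ζ) (ha : ∀ z, ‖z‖ ≤ 1 → |fderiv ℝ ζ z e| ≤ a)
    (hb : ∀ z, ‖z‖ ≤ 1 → |ζ z| ≤ b) :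
    (∫ z, density n z * (ζ z * V z)) ^ 2 ≤
      ((∫ z, density n z * U z ^ 2) - (∫ z, density n z * U z) ^ 2) *
        (2 * a ^ 2 + 8 * b ^ 2 * rootEnergy n) := by
  set q := rootDensity n with hq
  have hqc : ContDiff ℝ 1 q := rootDensity_contDiff.of_le (by simp)
  set k : En n → ℝ := fun z => fderiv ℝ ζ z e * q z + 2 * (ζ z * fderiv ℝ q z e) with hk
  set Φ : En n → ℝ := fun z => density n z * ζ z with hΦ
  have hΦc : ContDiff ℝ 1 Φ := (density_contDiff.of_le (by simp)).mul hζ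
  have hΦs : HasCompactSupport Φ := density_hasCompactSupport.mul_right
  have hderiv : ∀ z, fderiv ℝ Φ z e = q z * k z := by
    intro z
    have h1 : HasFDerivAt q (fderiv ℝ q z) z := (hqc.differentiable (by simp) z).hasFDerivAt
    have h2 : HasFDerivAt ζ (fderiv ℝ ζ z) z := (hζ.differentiable (by simp) z).hasFDerivAt
    have h3 : fderiv ℝ Φ z = _ := ((h1.pow 2).mul h2).fderiv
    rw [h3]
    simp [hk]
    ring
  have hζd : Continuous fun z => fderiv ℝ ζ z e :=
    (hζ.continuous_fderiv (by simp)).clm_apply continuous_const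
  have hqd : Continuous fun z => fderiv ℝ q z e :=
    (hqc.continuous_fderiv (by simp)).clm_apply continuous_const
  have hkc : Continuous k := by
    have := hqc.continuous
    have := hζ.continuous
    fun_prop
  have hks : HasCompactSupport k := by
    refine HasCompactSupport.add ?_ ?_
    · exact rootDensity_hasCompactSupport.mul_left
    · have : HasCompactSupport fun z => ζ z * fderiv ℝ q z e :=
        (rootDensity_hasCompactSupport.fderiv_apply ℝ e).mul_left
      exact this.mul_left
  set m := ∫ y, density n y * U y with hm
  have hzero : ∫ z, q z * k z = 0 := by
    have := integral_mul_fderiv_affine (LipschitzWith.const (1 : ℝ)) hΦc hΦs 0 e (r := 1)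
    simpa [hderiv] using this.symm
  have hqkc : Continuous fun z => q z * k z := hqc.continuous.mul hkc
  have hqks : HasCompactSupport fun z => q z * k z := rootDensity_hasCompactSupport.mul_right
  have hqk : Integrable fun z => q z * k z := hqkc.integrable_of_hasCompactSupport hqks
  have hmain : ∫ z, density n z * (ζ z * V z) = -∫ z, (q z * (U z - m)) * k z := by
    have h1 : ∫ z, density n z * (ζ z * V z) = ∫ z, Φ z * V z := by
      congr 1; ext z; simp only [hΦ]; ring
    have h2 : ∫ z, (q z * (U z - m)) * k z = (∫ z, (q z * k z) * U z) - m * ∫ z, q z * k z := by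
      rw [← integral_const_mul, ← integral_sub (hU.integrable_mul hqk) (hqk.const_mul m)]
      congr 1; ext z; ring
    rw [h1, hibp Φ hΦc hΦs, h2, hzero]
    simp [hderiv]
  have hUm : BddMeas fun z => U z - m := hU.sub (BddMeas.const m)
  have hk2c : Continuous fun z => k z ^ 2 := hkc.pow 2
  have hk2s : HasCompactSupport fun z => k z ^ 2 :=
    hks.comp_left (g := fun t : ℝ => t ^ 2) (by simp)
  have hk2 : Integrable fun z => k z ^ 2 := hk2c.integrable_of_hasCompactSupport hk2s
  have hcs := cauchy_schwarz_integral (f := fun z => q z * (U z - m)) (g := k)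
    (by
      have := hUm.sq.integrable_mul (density_integrable (n := n))
      simpa only [density, ← mul_pow] using this) hk2
    (by
      have := hUm.integrable_mul hqk
      refine this.congr (Eventually.of_forall fun z => ?_)
      ring)
  have hvar : ∫ z, (q z * (U z - m)) ^ 2 = (∫ z, density n z * U z ^ 2) - m ^ 2 := by
    have h := integral_density_mul_sub_sq hU
    rw [← hm] at h
    rw [← h]
    simp only [mul_pow]
    rfl
  have hkint : ∫ z, k z ^ 2 ≤ 2 * a ^ 2 + 8 * b ^ 2 * rootEnergy n := by
    obtain ⟨hi, hle⟩ := integral_dirDeriv_rootDensity_sq_le (n := n) he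
    have h1 : Integrable fun z => 2 * a ^ 2 * density n z := density_integrable.const_mul _
    have h2 : Integrable fun z => 8 * b ^ 2 * (fderiv ℝ (rootDensity n) z e) ^ 2 := hi.const_mul _
    have h3 : ∫ z, k z ^ 2 ≤
        ∫ z, (2 * a ^ 2 * density n z + 8 * b ^ 2 * (fderiv ℝ (rootDensity n) z e) ^ 2) := by
      refine integral_mono hk2 (h1.add h2) fun z => ?_
      simp only
      by_cases hz : ‖z‖ ≤ 1
      · have ha2 : (fderiv ℝ ζ z e) ^ 2 ≤ a ^ 2 := sq_le_sq' (by linarith [abs_le.1 (ha z hz)])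
          (abs_le.1 (ha z hz)).2
        have hb2 : (ζ z) ^ 2 ≤ b ^ 2 := sq_le_sq' (by linarith [abs_le.1 (hb z hz)])
          (abs_le.1 (hb z hz)).2
        have e1 : k z ^ 2 ≤ 2 * ((fderiv ℝ ζ z e) ^ 2 * q z ^ 2) +
            8 * ((ζ z) ^ 2 * (fderiv ℝ q z e) ^ 2) := by
          simp only [hk]
          nlinarith [sq_nonneg (fderiv ℝ ζ z e * q z - 2 * (ζ z * fderiv ℝ q z e))]
        have e2 := mul_le_mul_of_nonneg_right ha2 (sq_nonneg (q z))
        have e3 := mul_le_mul_of_nonneg_right hb2 (sq_nonneg (fderiv ℝ q z e))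
        simp only [density, ← hq]
        linarith
      · have hz' := not_le.1 hz
        have hq0 : q z = 0 := by simp [hq, rootDensity, profile_eq_zero hz'.le]
        have hd0 : fderiv ℝ q z = 0 := fderiv_rootDensity_eq_zero hz'
        simp [hk, hq0, hd0, density_eq_zero hz'.le, ← hq]
    rw [integral_add h1 h2, integral_const_mul, integral_const_mul, density_integral] at h3
    have := mul_le_mul_of_nonneg_left hle (by positivity : 0 ≤ 8 * b ^ 2)
    linarith
  rw [hmain, neg_sq]
  refine hcs.trans ?_
  rw [hvar]
  have hJ := jensen_density hU
  exact mul_le_mul_of_nonneg_left hkint (by linarith)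

/-- The dimensional constant in the averaged Bernstein inequality. -/
def bernsteinConst (n : ℕ) : ℝ := 40 * (1 + rootEnergy n)

lemma bernsteinConst_nonneg : 0 ≤ bernsteinConst n := by
  have := rootEnergy_nonneg (n := n)
  unfold bernsteinConst; positivity

lemma unit_scale_inequality {U V h : En n → ℝ} {e : En n} {N η₀ : ℝ} (hU : BddMeas U)
    (hV : BddMeas V) (he : ‖e‖ ≤ 1)
    (hibp : ∀ ψ : En n → ℝ, ContDiff ℝ 1 ψ → HasCompactSupport ψ →
      ∫ z, ψ z * V z = -∫ z, fderiv ℝ ψ z e * U z)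
    (hh : ContDiff ℝ 1 h) (hhB : BddMeas h)
    (hN : ∀ z, ‖z‖ ≤ 1 → |h z| ≤ N) (hN' : ∀ z, ‖z‖ ≤ 1 → |fderiv ℝ h z e| ≤ N)
    (hE : |η₀ * ∫ z, density n z * h z| ≤ N ^ 2) :
    η₀ ^ 2 * (∫ z, density n z * V z) ^ 2 -
        bernsteinConst n * N ^ 2 * ((∫ z, density n z * U z ^ 2) - (∫ z, density n z * U z) ^ 2) ≤
      ∫ z, density n z * ((η₀ + h z) ^ 2 * V z ^ 2) := by
  set m := ∫ z, density n z * V z with hm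
  set W := (∫ z, density n z * U z ^ 2) - (∫ z, density n z * U z) ^ 2 with hW
  have hW0 : 0 ≤ W := by have := jensen_density hU; linarith
  set B := ∫ z, density n z * (h z ^ 2 * V z) with hB
  set C1 := rootEnergy n with hC1
  have hC0 : 0 ≤ C1 := rootEnergy_nonneg
  have hN0 : 0 ≤ N := (abs_nonneg _).trans (hN 0 (by simp))
  have hm2 : m ^ 2 ≤ W * (8 * C1) := by
    have := sq_integral_weighted_le (ζ := fun _ => 1) (a := 0) (b := 1) hU he hibp
      contDiff_const (by simp) (by simp)
    simpa using this
  have hB2 : B ^ 2 ≤ W * (8 * N ^ 4 * (1 + C1)) := by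
    have hd : ∀ z, fderiv ℝ (fun z => h z ^ 2) z e = 2 * h z * fderiv ℝ h z e := by
      intro z
      rw [((hh.differentiable (by simp) z).hasFDerivAt.pow 2).fderiv]
      simp
    have := sq_integral_weighted_le (ζ := fun z => h z ^ 2) (a := 2 * N ^ 2) (b := N ^ 2) hU he hibp
      (hh.pow 2) (fun z hz => by
        rw [hd, abs_mul, abs_mul, abs_two]
        have := mul_le_mul (hN z hz) (hN' z hz) (abs_nonneg _) hN0
        nlinarith) (fun z hz => by
        rw [abs_pow]
        exact pow_le_pow_left₀ (abs_nonneg _) (hN z hz) 2)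
    convert this using 2
    ring
  have hmB : |m * B| ≤ 8 * (1 + C1) * N ^ 2 * W := by
    refine abs_le_of_sq_le_sq ?_ (by positivity)
    have h1 : m ^ 2 ≤ W * (8 * (1 + C1)) := hm2.trans (by nlinarith)
    have h2 := mul_le_mul h1 hB2 (sq_nonneg _) (by positivity)
    calc (m * B) ^ 2 = m ^ 2 * B ^ 2 := by ring
      _ ≤ _ := h2
      _ = _ := by ring
  have hη : ∀ z, (η₀ + h z) ^ 2 * V z ^ 2 =
      ((η₀ + h z) * V z - η₀ * m + m * h z) ^ 2 + η₀ ^ 2 * m ^ 2 * 1 - m ^ 2 * h z ^ 2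
        + 2 * m * (η₀ * (V z - m)) * η₀ + 2 * η₀ * m ^ 2 * h z
        - 2 * m * (h z ^ 2 * V z) := by
    intro z; ring
  set G : En n → ℝ := fun z => (η₀ + h z) * V z - η₀ * m + m * h z with hG
  have bG : BddMeas G := by
    have b1 := ((BddMeas.const η₀).add hhB).mul hV
    exact (b1.sub (BddMeas.const (η₀ * m))).add ((BddMeas.const m).mul hhB)
  have iG := bG.sq.integrable_mul (density_integrable (n := n))
  have ih := hhB.integrable_mul (density_integrable (n := n))
  have ih2 := hhB.sq.integrable_mul (density_integrable (n := n))
  have iV := hV.integrable_mul (density_integrable (n := n))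
  have ihV := (hhB.sq.mul hV).integrable_mul (density_integrable (n := n))
  have i0 := density_integrable (n := n)
  have hintg : ∫ z, density n z * ((η₀ + h z) ^ 2 * V z ^ 2) =
      (∫ z, density n z * G z ^ 2) + η₀ ^ 2 * m ^ 2 - m ^ 2 * (∫ z, density n z * h z ^ 2)
        + 2 * η₀ * m ^ 2 * (∫ z, density n z * h z) - 2 * m * B := by
    have e1 : ∀ z, density n z * ((η₀ + h z) ^ 2 * V z ^ 2) =
        ((((density n z * G z ^ 2 + (- η₀ ^ 2 * m ^ 2) * density n z)
          + (-m ^ 2) * (density n z * h z ^ 2))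
          + (2 * m * η₀ ^ 2) * (density n z * V z))
          + (2 * η₀ * m ^ 2) * (density n z * h z))
          + (-2 * m) * (density n z * (h z ^ 2 * V z)) := by
      intro z; simp only [hG]; ring
    simp_rw [e1]
    have j1 : Integrable fun z => density n z * G z ^ 2 + (- η₀ ^ 2 * m ^ 2) * density n z :=
      iG.add (i0.const_mul _)
    have j2 : Integrable fun z => (density n z * G z ^ 2 + (- η₀ ^ 2 * m ^ 2) * density n z)
          + (-m ^ 2) * (density n z * h z ^ 2) := j1.add (ih2.const_mul _)
    have j3 : Integrable fun z => ((density n z * G z ^ 2 + (- η₀ ^ 2 * m ^ 2) * density n z)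
          + (-m ^ 2) * (density n z * h z ^ 2)) + (2 * m * η₀ ^ 2) * (density n z * V z) :=
      j2.add (iV.const_mul _)
    have j4 : Integrable fun z => (((density n z * G z ^ 2 + (- η₀ ^ 2 * m ^ 2) * density n z)
          + (-m ^ 2) * (density n z * h z ^ 2)) + (2 * m * η₀ ^ 2) * (density n z * V z))
          + (2 * η₀ * m ^ 2) * (density n z * h z) := j3.add (ih.const_mul _)
    rw [integral_add j4 (ihV.const_mul _), integral_add j3 (ih.const_mul _),
      integral_add j2 (iV.const_mul _), integral_add j1 (ih2.const_mul _),
      integral_add iG (i0.const_mul _)]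
    simp only [integral_const_mul, density_integral, ← hm, ← hB]
    ring
  have hG0 : 0 ≤ ∫ z, density n z * G z ^ 2 :=
    integral_nonneg fun z => mul_nonneg (density_nonneg z) (sq_nonneg _)
  have hh2 : ∫ z, density n z * h z ^ 2 ≤ N ^ 2 := by
    have : ∫ z, density n z * h z ^ 2 ≤ ∫ z, density n z * N ^ 2 := by
      refine integral_mono ih2 (i0.mul_const _) fun z => ?_
      simp only
      by_cases hz : ‖z‖ ≤ 1
      · refine mul_le_mul_of_nonneg_left ?_ (density_nonneg z)
        rw [← sq_abs]
        exact pow_le_pow_left₀ (abs_nonneg _) (hN z hz) 2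
      · simp [density_eq_zero (not_le.1 hz).le]
    rwa [integral_mul_const, density_integral, one_mul] at this
  rw [hintg]
  have hE' := (abs_le.1 hE).1
  have hmB' := (abs_le.1 hmB).2
  have hm0 := sq_nonneg m
  have t1 := mul_le_mul_of_nonneg_left hh2 hm0
  have t2 := mul_le_mul_of_nonneg_left hE' hm0
  have t3 := mul_le_mul_of_nonneg_right hm2 (sq_nonneg N)
  have t4 : 0 ≤ W * N ^ 2 := mul_nonneg hW0 (sq_nonneg N)
  simp only [bernsteinConst, ← hC1]
  nlinarith

/-- Second differences of a function with Lipschitz derivative are quadratically small. -/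
lemma abs_second_diff_le {f : En n → ℝ} {x z : En n} {δ M : ℝ}
    (hf : ∀ y ∈ ball x δ, DifferentiableAt ℝ f y)
    (hL : ∀ y ∈ ball x δ, ∀ y' ∈ ball x δ, ‖fderiv ℝ f y - fderiv ℝ f y'‖ ≤ M * ‖y - y'‖)
    (hz : ‖z‖ < δ) : |2 * f x - f (x + z) - f (x - z)| ≤ M * ‖z‖ ^ 2 := by
  set S : Set (En n) := {y | y ∈ ball x δ ∧ z + y ∈ ball x δ} with hS
  have hSc : Convex ℝ S :=
    (convex_ball x δ).inter ((convex_ball x δ).translate_preimage_right z)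
  have hd : ∀ y ∈ S, HasFDerivAt (fun y => f (z + y) - f y)
      (fderiv ℝ f (z + y) - fderiv ℝ f y) y := by
    intro y hy
    have h1 : HasFDerivAt (fun y => f (z + y)) (fderiv ℝ f (z + y)) y :=
      (hasFDerivAt_comp_add_left z).2 (hf _ hy.2).hasFDerivAt
    exact h1.sub (hf _ hy.1).hasFDerivAt
  have hxS : x ∈ S := ⟨by simpa using (norm_nonneg z).trans_lt hz, by simpa [dist_eq_norm] using hz⟩
  have hxS' : x - z ∈ S := by
    refine ⟨by simpa [dist_eq_norm] using hz, ?_⟩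
    have : z + (x - z) = x := by abel
    rw [this]
    simpa using (norm_nonneg z).trans_lt hz
  have h := hSc.norm_image_sub_le_of_norm_fderiv_le (𝕜 := ℝ) (C := M * ‖z‖)
    (fun y hy => (hd y hy).differentiableAt)
    (fun y hy => by
      rw [(hd y hy).fderiv]
      have := hL _ hy.2 _ hy.1
      rwa [add_sub_cancel_right] at this) hxS' hxS
  have e1 : z + (x - z) = x := by abel
  have e2 : x - (x - z) = z := by abel
  simp only [e1, e2, Real.norm_eq_abs] at h
  calc |2 * f x - f (x + z) - f (x - z)| = |f (z + x) - f x - (f x - f (x - z))| := by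
        rw [← abs_neg, add_comm z x]; congr 1; ring
    _ ≤ M * ‖z‖ * ‖z‖ := h
    _ = _ := by ring

lemma c2BddBy_fderiv_lipschitz {η : En n → ℝ} {M : ℝ} (hη : ContDiff ℝ 2 η)
    (hM : C2BddBy n η M) (y y' : En n) :
    ‖fderiv ℝ η y - fderiv ℝ η y'‖ ≤ M * ‖y - y'‖ := by
  have hd : Differentiable ℝ (fderiv ℝ η) :=
    (hη.fderiv_right (m := 1) (by norm_num)).differentiable (by simp)
  exact convex_univ.norm_image_sub_le_of_norm_fderiv_le (𝕜 := ℝ) (fun y _ => hd y)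
    (fun y _ => (hM y).2.2) (mem_univ _) (mem_univ _)

lemma c2BddBy_lipschitz {η : En n → ℝ} {M : ℝ} (hη : ContDiff ℝ 2 η)
    (hM : C2BddBy n η M) (y y' : En n) : |η y - η y'| ≤ M * ‖y - y'‖ :=
  convex_univ.norm_image_sub_le_of_norm_fderiv_le (𝕜 := ℝ)
    (fun y _ => (hη.differentiable (by simp)) y)
    (fun y _ => (hM y).2.1) (mem_univ _) (mem_univ _)

lemma c2BddBy_bddMeas {η : En n → ℝ} {M : ℝ} (hη : ContDiff ℝ 2 η)
    (hM : C2BddBy n η M) : BddMeas η := ⟨hη.continuous.measurable, M, fun x => (hM x).1⟩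

lemma avg_add {f g : En n → ℝ} (hf : BddMeas f) (hg : BddMeas g) (r : ℝ) (x : En n) :
    avg r (fun y => f y + g y) x = avg r f x + avg r g x := by
  simp only [avg, mul_add]
  exact integral_add ((hf.comp_affine x r).integrable_mul density_integrable)
    ((hg.comp_affine x r).integrable_mul density_integrable)

lemma avg_const_mul (c : ℝ) (f : En n → ℝ) (r : ℝ) (x : En n) :
    avg r (fun y => c * f y) x = c * avg r f x := by
  simp only [avg, mul_left_comm _ c, integral_const_mul]

lemma avg_neg_smul (f : En n → ℝ) (r : ℝ) (x : En n) :
    avg r f x = ∫ z, density n z * f (x - r • z) := by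
  rw [avg, ← integral_neg_eq_self]
  congr 1; ext z
  rw [density_congr (norm_neg z), smul_neg, sub_eq_add_neg]

/-- The deviation from the average is an average of second differences. -/
lemma sub_avg_eq {f : En n → ℝ} (hf : BddMeas f) (r : ℝ) (x : En n) :
    2 * (f x - avg r f x) =
      ∫ z, density n z * (2 * f x - f (x + r • z) - f (x - r • z)) := by
  have i1 : Integrable fun z => density n z * (2 * f x) := density_integrable.mul_const _
  have i2 : Integrable fun z => density n z * f (x + r • z) :=
    (hf.comp_affine x r).integrable_mul density_integrable
  have i3 : Integrable fun z => density n z * f (x - r • z) := by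
    have := (hf.comp_affine x (-r)).integrable_mul (density_integrable (n := n))
    simpa only [neg_smul, ← sub_eq_add_neg] using this
  simp only [mul_sub (density n _)]
  have i4 : Integrable fun z => density n z * (2 * f x) - density n z * f (x + r • z) := i1.sub i2
  rw [integral_sub i4 i3, integral_sub i1 i2, ← avg_neg_smul, integral_mul_const, density_integral]
  simp only [avg]
  ring

lemma abs_sub_avg_le {f : En n → ℝ} (hf : BddMeas f) {r A : ℝ} {x : En n}
    (hA : ∀ z, ‖z‖ ≤ 1 → |2 * f x - f (x + r • z) - f (x - r • z)| ≤ A) :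
    |f x - avg r f x| ≤ A / 2 := by
  have h := sub_avg_eq hf r x
  have h2 : |∫ z, density n z * (2 * f x - f (x + r • z) - f (x - r • z))| ≤
      ∫ z, density n z * A := by
    rw [← Real.norm_eq_abs]
    refine norm_integral_le_of_norm_le
      (f := fun z => density n z * (2 * f x - f (x + r • z) - f (x - r • z)))
      (density_integrable.mul_const A) (Eventually.of_forall fun z => ?_)
    rw [Real.norm_eq_abs, abs_mul, abs_of_nonneg (density_nonneg z)]
    by_cases hz : ‖z‖ ≤ 1
    · exact mul_le_mul_of_nonneg_left (hA z hz) (density_nonneg z)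
    · simp [density_eq_zero (not_le.1 hz).le]
  rw [integral_mul_const, density_integral, one_mul, ← h, abs_mul, abs_two] at h2
  linarith

lemma bddMeas_dirDeriv {u : En n → ℝ} {L : ℝ≥0} (hu : LipschitzWith L u) (e : En n) :
    BddMeas fun y => fderiv ℝ u y e := by
  refine ⟨measurable_fderiv_apply_const ℝ u e, L * ‖e‖, fun x => ?_⟩
  rw [← Real.norm_eq_abs]
  exact ((fderiv ℝ u x).le_opNorm e).trans
    (mul_le_mul_of_nonneg_right (norm_fderiv_le_of_lipschitz ℝ hu) (norm_nonneg _))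

/-- Averaged Bernstein inequality at scale `r`. -/
lemma avg_bernstein {u η : En n → ℝ} {L : ℝ≥0} {M : ℝ} {e : En n} (hub : BddMeas u)
    (hu : LipschitzWith L u) (hη : ContDiff ℝ 2 η) (hM : C2BddBy n η M) (he : ‖e‖ ≤ 1)
    {r : ℝ} (hr : 0 < r) (x : En n) :
    η x ^ 2 * avg r (fun y => fderiv ℝ u y e) x ^ 2 -
        bernsteinConst n * M ^ 2 * (avg r (fun y => u y ^ 2) x - avg r u x ^ 2) ≤
      avg r (fun y => η y ^ 2 * fderiv ℝ u y e ^ 2) x := by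
  have hM0 : 0 ≤ M := (abs_nonneg _).trans (hM 0).1
  have hηb := c2BddBy_bddMeas hη hM
  have hηd : ∀ z, fderiv ℝ (fun z => η (x + r • z) - η x) z = r • fderiv ℝ η (x + r • z) := by
    intro z
    rw [fderiv_sub_const]
    have := fderiv_comp_smul (𝕜 := ℝ) (f := fun y => η (x + y)) (x := z) r
    simp only [fderiv_comp_add_left] at this
    exact this
  have key := unit_scale_inequality (n := n) (U := fun z => u (x + r • z))
    (V := fun z => r * fderiv ℝ u (x + r • z) e) (h := fun z => η (x + r • z) - η x) (e := e)
    (N := M * r) (η₀ := η x) (hub.comp_affine x r)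
    ((BddMeas.const r).mul ((bddMeas_dirDeriv hu e).comp_affine x r)) he
    (fun ψ hψ hψs => integral_mul_fderiv_affine hu hψ hψs x e)
    (by
      have := hη.of_le (show (1 : WithTop ℕ∞) ≤ 2 by norm_num)
      fun_prop)
    ((hηb.comp_affine x r).sub (BddMeas.const _))
    (fun z hz => by
      refine (c2BddBy_lipschitz hη hM _ _).trans ?_
      rw [add_sub_cancel_left, norm_smul, Real.norm_of_nonneg hr.le]
      exact mul_le_mul_of_nonneg_left (mul_le_of_le_one_right hr.le hz) hM0)
    (fun z hz => by
      rw [hηd, smul_apply, smul_eq_mul, abs_mul, abs_of_pos hr, mul_comm]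
      refine mul_le_mul_of_nonneg_right ?_ hr.le
      rw [← Real.norm_eq_abs]
      exact ((fderiv ℝ η _).le_opNorm e).trans ((mul_le_of_le_one_right (norm_nonneg _) he).trans
        (hM _).2.1))
    (by
      have h1 : ∫ z, density n z * (η (x + r • z) - η x) = -(η x - avg r η x) := by
        simp only [mul_sub]
        rw [integral_sub ((hηb.comp_affine x r).integrable_mul density_integrable)
          (density_integrable.mul_const _), integral_mul_const, density_integral]
        simp [avg]
      have h2 := abs_sub_avg_le (A := M * r ^ 2) (r := r) (x := x) hηb (fun z hz => by
        have h := abs_second_diff_le (f := η) (x := x) (z := r • z) (δ := ‖r • z‖ + 1) (M := M)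
          (fun y _ => (hη.differentiable (by simp)) y)
          (fun y _ y' _ => c2BddBy_fderiv_lipschitz hη hM y y') (by linarith)
        refine h.trans (mul_le_mul_of_nonneg_left ?_ hM0)
        rw [norm_smul, Real.norm_of_nonneg hr.le, mul_pow]
        exact mul_le_of_le_one_right (sq_nonneg r) (pow_le_one₀ (norm_nonneg _) hz))
      rw [h1, abs_mul, abs_neg]
      have h3 := mul_le_mul (hM x).1 h2 (abs_nonneg _) hM0
      nlinarith [sq_nonneg (M * r)])
  have hr2 : 0 < r ^ 2 := by positivity
  have e1 : ∫ z, density n z * (r * fderiv ℝ u (x + r • z) e) =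
      r * avg r (fun y => fderiv ℝ u y e) x := by
    rw [avg, ← integral_const_mul]; congr 1; ext z; ring
  have e2 : ∫ z, density n z * ((η x + (η (x + r • z) - η x)) ^ 2 *
      (r * fderiv ℝ u (x + r • z) e) ^ 2) =
      r ^ 2 * avg r (fun y => η y ^ 2 * fderiv ℝ u y e ^ 2) x := by
    rw [avg, ← integral_const_mul]; congr 1; ext z; ring
  rw [e1, e2] at key
  refine le_of_mul_le_mul_left ?_ hr2
  refine le_trans (le_of_eq ?_) key
  simp only [avg]
  ring

/-- The Bernstein function in direction `e`. -/
def bernstein (η u : En n → ℝ) (σ : ℝ) (e y : En n) : ℝ :=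
  η y ^ 2 * fderiv ℝ u y e ^ 2 + σ * u y ^ 2

lemma bddMeas_bernstein {u η : En n → ℝ} {L : ℝ≥0} (hub : BddMeas u)
    (hu : LipschitzWith L u) (hη : BddMeas η) (σ : ℝ) (e : En n) :
    BddMeas (bernstein η u σ e) :=
  (hη.sq.mul (bddMeas_dirDeriv hu e).sq).add ((BddMeas.const σ).mul hub.sq)

lemma bernstein_sub_avg_le {u η : En n → ℝ} {L : ℝ≥0} {M σ : ℝ} {e : En n} (hub : BddMeas u)
    (hu : LipschitzWith L u) (hη : ContDiff ℝ 2 η) (hM : C2BddBy n η M) (he : ‖e‖ ≤ 1)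
    (hσ : bernsteinConst n * M ^ 2 ≤ σ) {r : ℝ} (hr : 0 < r) (x : En n) :
    bernstein η u σ e x - avg r (bernstein η u σ e) x ≤
      2 * η x ^ 2 * fderiv ℝ u x e * (fderiv ℝ u x e - avg r (fun y => fderiv ℝ u y e) x) +
        2 * σ * u x * (u x - avg r u x) := by
  have h1 := avg_bernstein hub hu hη hM he hr x
  have hσ0 : 0 ≤ σ := le_trans (mul_nonneg bernsteinConst_nonneg (sq_nonneg M)) hσ
  have hJ : avg r u x ^ 2 ≤ avg r (fun y => u y ^ 2) x := jensen_density (hub.comp_affine x r)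
  have h2 : avg r (bernstein η u σ e) x = avg r (fun y => η y ^ 2 * fderiv ℝ u y e ^ 2) x +
      σ * avg r (fun y => u y ^ 2) x := by
    rw [← avg_const_mul, ← avg_add ((c2BddBy_bddMeas hη hM).sq.mul (bddMeas_dirDeriv hu e).sq)
      ((BddMeas.const σ).mul hub.sq)]
    rfl
  rw [h2]
  simp only [bernstein]
  set m := avg r (fun y => fderiv ℝ u y e) x
  set v := fderiv ℝ u x e
  set a := avg r u x
  set b := avg r (fun y => u y ^ 2) x
  nlinarith [mul_nonneg (sub_nonneg.2 hσ) (sub_nonneg.2 hJ), sq_nonneg (η x * (v - m)),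
    mul_nonneg hσ0 (sq_nonneg (u x - a))]

/-- The measure `r ^ (-1-2s) dr` on scales `r > 0`. -/
def scaleMeasure (s : ℝ) : Measure ℝ :=
  (volume.restrict (Ioi 0)).withDensity fun r => ENNReal.ofReal (r ^ (-1 - 2 * s))

/-- The probability measure with density `density n`. -/
def densityMeasure (n : ℕ) : Measure (En n) :=
  volume.withDensity fun z => ENNReal.ofReal (density n z)

/-- The jump measure `‖z‖ ^ (-n-2s) dz` of the fractional Laplacian. -/
def jumpMeasure (n : ℕ) (s : ℝ) : Measure (En n) :=
  volume.withDensity fun z => ENNReal.ofReal (‖z‖ ^ (-((n : ℝ) + 2 * s)))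

instance (s : ℝ) : SigmaFinite (scaleMeasure s) := SigmaFinite.withDensity_ofReal _

instance : SigmaFinite (densityMeasure n) := SigmaFinite.withDensity_ofReal _

instance : IsProbabilityMeasure (densityMeasure n) := by
  constructor
  rw [densityMeasure, withDensity_apply _ MeasurableSet.univ, Measure.restrict_univ,
    ← ofReal_integral_eq_lintegral_ofReal density_integrable
      (Eventually.of_forall density_nonneg), density_integral, ENNReal.ofReal_one]

lemma integral_densityMeasure (f : En n → ℝ) :
    ∫ z, f z ∂densityMeasure n = ∫ z, density n z * f z := by
  rw [densityMeasure, integral_withDensity_eq_integral_toReal_smul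
    density_continuous.measurable.ennreal_ofReal (by simp)]
  simp only [ENNReal.toReal_ofReal (density_nonneg _), smul_eq_mul]

lemma integral_jumpMeasure (s : ℝ) (f : En n → ℝ) :
    ∫ z, f z ∂jumpMeasure n s = ∫ z, ‖z‖ ^ (-((n : ℝ) + 2 * s)) * f z := by
  rw [jumpMeasure, integral_withDensity_eq_integral_toReal_smul (by fun_prop) (by simp)]
  congr 1; ext z
  rw [ENNReal.toReal_ofReal (Real.rpow_nonneg (norm_nonneg z) _), smul_eq_mul]

lemma integrable_scaleMeasure_iff {s : ℝ} {f : ℝ → ℝ} :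
    Integrable f (scaleMeasure s) ↔ IntegrableOn (fun r => r ^ (-1 - 2 * s) * f r) (Ioi 0) := by
  rw [scaleMeasure, integrable_withDensity_iff_integrable_smul' (by fun_prop) (by simp),
    IntegrableOn]
  refine integrable_congr ?_
  filter_upwards [ae_restrict_mem measurableSet_Ioi] with r hr
  simp only [ENNReal.toReal_ofReal (Real.rpow_nonneg (mem_Ioi.1 hr).le _), smul_eq_mul]

lemma scaleMeasure_ae_pos (s : ℝ) : ∀ᵐ r ∂scaleMeasure s, 0 < r :=
  (withDensity_absolutelyContinuous _ _).ae_le (ae_restrict_mem measurableSet_Ioi)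

lemma integrable_min_scaleMeasure {s : ℝ} (hs : s ∈ Ioo (0 : ℝ) 1) :
    Integrable (fun r : ℝ => min 1 (r ^ 2)) (scaleMeasure s) := by
  rw [integrable_scaleMeasure_iff, ← Ioc_union_Ioi_eq_Ioi zero_le_one]
  refine IntegrableOn.union ?_ ?_
  · have h : IntegrableOn (fun r : ℝ => r ^ (1 - 2 * s)) (Ioc 0 1) := by
      have := intervalIntegral.intervalIntegrable_rpow' (a := 0) (b := 1) (r := 1 - 2 * s)
        (by linarith [hs.2])
      rwa [intervalIntegrable_iff_integrableOn_Ioc_of_le zero_le_one] at this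
    refine h.congr_fun (fun r hr => ?_) measurableSet_Ioc
    have h1 : r ^ 2 ≤ 1 := pow_le_one₀ hr.1.le hr.2
    simp only [min_eq_right h1]
    rw [← Real.rpow_natCast, ← Real.rpow_add hr.1]
    congr 1; push_cast; ring
  · have h : IntegrableOn (fun r : ℝ => r ^ (-1 - 2 * s)) (Ioi 1) :=
      integrableOn_Ioi_rpow_of_lt (by linarith [hs.1]) one_pos
    refine h.congr_fun (fun r hr => ?_) measurableSet_Ioi
    have h1 : 1 ≤ r ^ 2 := one_le_pow₀ (mem_Ioi.1 hr).le
    simp [min_eq_left h1]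

lemma lintegral_comp_smul_pos {E : Type*} [NormedAddCommGroup E] [NormedSpace ℝ E]
    [FiniteDimensional ℝ E] [MeasurableSpace E] [BorelSpace E] (μ : Measure E)
    [μ.IsAddHaarMeasure] {g : E → ENNReal} (hg : Measurable g) {r : ℝ} (hr : 0 < r) :
    ∫⁻ z, g (r • z) ∂μ = ENNReal.ofReal (r ^ Module.finrank ℝ E)⁻¹ * ∫⁻ z, g z ∂μ := by
  have h := Measure.map_addHaar_smul μ hr.ne'
  rw [← lintegral_map (f := g) hg (measurable_const_smul r), h, lintegral_smul_measure,
    abs_of_pos (by positivity), smul_eq_mul]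

/-- Radial profile of the jump kernel obtained by superposing dilations of the density. -/
def layerProfile (s : ℝ) (z : En n) (r : ℝ) : ℝ :=
  (Ioi (0 : ℝ)).indicator (fun r => r ^ (-1 - 2 * s) * (r ^ n)⁻¹ * density n (r⁻¹ • z)) r

lemma layerProfile_nonneg (s : ℝ) (z : En n) (r : ℝ) : 0 ≤ layerProfile s z r :=
  indicator_nonneg (fun _ hr => mul_nonneg (mul_nonneg (Real.rpow_nonneg (mem_Ioi.1 hr).le _)
    (inv_nonneg.2 (pow_nonneg (mem_Ioi.1 hr).le _))) (density_nonneg _)) r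

lemma measurable_layerProfile (s : ℝ) (z : En n) : Measurable (layerProfile s z) := by
  refine Measurable.indicator ?_ measurableSet_Ioi
  have : Measurable fun r : ℝ => density n (r⁻¹ • z) :=
    density_continuous.measurable.comp (by fun_prop)
  fun_prop

lemma layerProfile_smul (s : ℝ) {z e : En n} (hz : z ≠ 0) (he : ‖e‖ = 1) (ρ : ℝ) :
    layerProfile s z (‖z‖ * ρ) =
      ‖z‖ ^ (-1 - 2 * s) * (‖z‖ ^ n)⁻¹ * layerProfile s e ρ := by
  have hz' : 0 < ‖z‖ := norm_pos_iff.2 hz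
  by_cases hρ : 0 < ρ
  · have h1 : ‖z‖ * ρ ∈ Ioi (0 : ℝ) := mul_pos hz' hρ
    rw [layerProfile, layerProfile, indicator_of_mem h1, indicator_of_mem (mem_Ioi.2 hρ),
      Real.mul_rpow hz'.le hρ.le, mul_pow, density_congr (w := ρ⁻¹ • e)]
    · rw [mul_inv]; ring
    · rw [norm_smul, norm_smul, he, norm_inv, norm_inv, norm_mul, norm_norm]
      field_simp
  · have h1 : ‖z‖ * ρ ∉ Ioi (0 : ℝ) := by
      simpa using mul_nonpos_of_nonneg_of_nonpos hz'.le (not_lt.1 hρ)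
    rw [layerProfile, layerProfile, indicator_of_notMem h1, indicator_of_notMem (by simpa using hρ),
      mul_zero]

lemma lintegral_layerProfile (s : ℝ) {z e : En n} (hz : z ≠ 0) (he : ‖e‖ = 1) :
    ∫⁻ r, ENNReal.ofReal (layerProfile s z r) =
      ENNReal.ofReal (‖z‖ ^ (-((n : ℝ) + 2 * s))) *
        ∫⁻ r, ENNReal.ofReal (layerProfile s e r) := by
  have hz' : 0 < ‖z‖ := norm_pos_iff.2 hz
  have h := lintegral_comp_smul_pos (volume : Measure ℝ)
    (measurable_layerProfile s z).ennreal_ofReal hz'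
  simp only [smul_eq_mul, layerProfile_smul s hz he, Module.finrank_self, pow_one] at h
  have hc : 0 ≤ ‖z‖ ^ (-1 - 2 * s) * (‖z‖ ^ n)⁻¹ := by positivity
  simp only [ENNReal.ofReal_mul hc] at h
  rw [lintegral_const_mul _ (measurable_layerProfile s e).ennreal_ofReal] at h
  have h2 : ENNReal.ofReal ‖z‖ * ENNReal.ofReal ‖z‖⁻¹ = 1 := by
    rw [← ENNReal.ofReal_mul hz'.le, mul_inv_cancel₀ hz'.ne', ENNReal.ofReal_one]
  rw [← one_mul (∫⁻ r, ENNReal.ofReal (layerProfile s z r)), ← h2, mul_assoc, ← h, ← mul_assoc,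
    ← ENNReal.ofReal_mul hz'.le]
  congr 2
  rw [show -((n : ℝ) + 2 * s) = 1 + (-1 - 2 * s) + -(n : ℝ) by ring, Real.rpow_add hz',
    Real.rpow_add hz', Real.rpow_one, Real.rpow_neg hz'.le, Real.rpow_natCast]
  ring

lemma lintegral_layerProfile_ne_zero (s : ℝ) (e : En n) :
    ∫⁻ r, ENNReal.ofReal (layerProfile s e r) ≠ 0 := by
  have hev : ∀ᶠ r : ℝ in atTop, 0 < density n (r⁻¹ • e) := by
    have h : Tendsto (fun r : ℝ => density n (r⁻¹ • e)) atTop (nhds (density n 0)) := by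
      refine (density_continuous.tendsto 0).comp ?_
      simpa using (tendsto_inv_atTop_zero (𝕜 := ℝ)).smul_const e
    exact (tendsto_order.1 h).1 _ density_zero_pos
  obtain ⟨R, hR⟩ := eventually_atTop.1 hev
  intro h0
  rw [lintegral_eq_zero_iff (measurable_layerProfile s e).ennreal_ofReal] at h0
  have h1 : ∀ᵐ r : ℝ, r ∉ Ioi (max R 0) := by
    filter_upwards [h0] with r hr hr'
    have hr0 : 0 < r := (le_max_right _ _).trans_lt hr'
    have := hR r ((le_max_left _ _).trans hr'.le)
    simp only [Pi.zero_apply, ENNReal.ofReal_eq_zero] at hr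
    rw [layerProfile, indicator_of_mem (mem_Ioi.2 hr0)] at hr
    have : 0 < r ^ (-1 - 2 * s) * (r ^ n)⁻¹ * density n (r⁻¹ • e) := by positivity
    linarith
  have h2 : volume (Ioi (max R 0)) = 0 := by
    rw [ae_iff] at h1
    convert h1 using 2
    ext r
    simp only [not_not]; rfl
  simp at h2

lemma lintegral_layerProfile_ne_top {s : ℝ} (hs : 0 < s) {e : En n} (he : ‖e‖ = 1) :
    ∫⁻ r, ENNReal.ofReal (layerProfile s e r) ≠ ⊤ := by
  obtain ⟨-, C, hC⟩ := bddMeas_of_hasCompactSupport (density_continuous (n := n))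
    density_hasCompactSupport
  have hi : IntegrableOn (fun r : ℝ => r ^ (-1 - 2 * s) * C) (Ioi 1) :=
    (integrableOn_Ioi_rpow_of_lt (by linarith) one_pos).mul_const _
  have hi' := (integrable_indicator_iff measurableSet_Ioi).2 hi
  refine (Integrable.mono' hi' (measurable_layerProfile s e).aestronglyMeasurable
    (Eventually.of_forall fun r => ?_)).lintegral_lt_top.ne
  rw [Real.norm_of_nonneg (layerProfile_nonneg _ _ _)]
  by_cases h1 : 1 < r
  · have hr0 : 0 < r := one_pos.trans h1
    rw [indicator_of_mem (mem_Ioi.2 h1), layerProfile, indicator_of_mem (mem_Ioi.2 hr0), mul_assoc]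
    refine mul_le_mul_of_nonneg_left ?_ (Real.rpow_nonneg hr0.le _)
    refine (mul_le_of_le_one_left (density_nonneg _)
      (inv_le_one_of_one_le₀ (one_le_pow₀ h1.le))).trans ((le_abs_self _).trans (hC _))
  · rw [indicator_of_notMem (by simpa using h1), layerProfile]
    by_cases hr0 : 0 < r
    · rw [indicator_of_mem (mem_Ioi.2 hr0), density_eq_zero, mul_zero]
      rw [norm_smul, he, mul_one, norm_inv, Real.norm_of_nonneg hr0.le]
      exact (one_le_inv₀ hr0).2 (not_lt.1 h1)
    · rw [indicator_of_notMem (by simpa using hr0)]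

/-- The jump measure is a superposition of dilations of the density measure. -/
lemma exists_map_smul_eq_jumpMeasure (hn : 0 < n) {s : ℝ} (hs : 0 < s) :
    ∃ κ : ENNReal, κ ≠ 0 ∧ κ ≠ ⊤ ∧
      ((scaleMeasure s).prod (densityMeasure n)).map (fun p => p.1 • p.2) =
        κ • jumpMeasure n s := by
  have : Nonempty (Fin n) := ⟨⟨0, hn⟩⟩
  obtain ⟨e, he⟩ := exists_norm_eq (En n) zero_le_one
  refine ⟨_, lintegral_layerProfile_ne_zero s e, lintegral_layerProfile_ne_top hs he, ?_⟩
  have hsm : Measurable fun p : ℝ × En n => p.1 • p.2 := by fun_prop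
  ext S hS
  set G : En n → ENNReal := S.indicator 1 with hG
  have hGm : Measurable G := measurable_one.indicator hS
  have hGs : Measurable fun p : ℝ × En n => G (p.1 • p.2) := hGm.comp hsm
  have hd : Measurable fun z => ENNReal.ofReal (density n z) :=
    density_continuous.measurable.ennreal_ofReal
  rw [← lintegral_indicator_one hS, ← hG, lintegral_map hGm hsm,
    lintegral_prod (fun p : ℝ × En n => G (p.1 • p.2)) hGs.aemeasurable]
  rw [scaleMeasure, lintegral_withDensity_eq_lintegral_mul _ (by fun_prop)
    hGs.lintegral_prod_right']
  have h1 : ∀ r ∈ Ioi (0 : ℝ), ENNReal.ofReal (r ^ (-1 - 2 * s)) *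
      ∫⁻ z, G (r • z) ∂densityMeasure n =
      ∫⁻ z, ENNReal.ofReal (layerProfile s z r) * G z := by
    intro r hr
    have hr0 := mem_Ioi.1 hr
    have hGr : Measurable fun z => G (r • z) := hGm.comp (measurable_const_smul r)
    rw [densityMeasure, lintegral_withDensity_eq_lintegral_mul _ hd hGr]
    have h2 := lintegral_comp_smul_pos (volume : Measure (En n))
      (g := fun z => ENNReal.ofReal (density n (r⁻¹ • z)) * G z)
      ((hd.comp (measurable_const_smul r⁻¹)).mul hGm) hr0
    simp only [inv_smul_smul₀ hr0.ne', finrank_euclideanSpace_fin] at h2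
    simp only [Pi.mul_apply]
    have hm : Measurable fun z => ENNReal.ofReal (density n (r⁻¹ • z)) * G z :=
      (hd.comp (measurable_const_smul r⁻¹)).mul hGm
    rw [h2, ← lintegral_const_mul _ hm, ← lintegral_const_mul _ (hm.const_mul _)]
    congr 1; ext z
    rw [layerProfile, indicator_of_mem hr, ENNReal.ofReal_mul (by positivity),
      ENNReal.ofReal_mul (by positivity)]
    ring
  simp only [Pi.mul_apply]
  rw [setLIntegral_congr_fun measurableSet_Ioi h1]
  have hjm : Measurable fun p : ℝ × En n => ENNReal.ofReal (layerProfile s p.2 p.1) * G p.2 := by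
    refine Measurable.mul (Measurable.ennreal_ofReal ?_) (hGm.comp measurable_snd)
    have : Measurable fun p : ℝ × En n => density n (p.1⁻¹ • p.2) :=
      density_continuous.measurable.comp (by fun_prop)
    have h3 : Measurable fun p : ℝ × En n =>
        p.1 ^ (-1 - 2 * s) * (p.1 ^ n)⁻¹ * density n (p.1⁻¹ • p.2) := by fun_prop
    exact h3.indicator (measurable_fst measurableSet_Ioi)
  rw [lintegral_lintegral_swap (f := fun r z => ENNReal.ofReal (layerProfile s z r) * G z)
    hjm.aemeasurable]
  have h0 : ∀ᵐ z : En n, z ≠ 0 := by simp [ae_iff]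
  rw [Measure.smul_apply, jumpMeasure, withDensity_apply _ hS, smul_eq_mul,
    ← lintegral_const_mul _ (by fun_prop), ← lintegral_indicator hS]
  refine lintegral_congr_ae ?_
  filter_upwards [h0] with z hz
  rw [lintegral_mul_const _ (measurable_layerProfile s z).ennreal_ofReal]
  have h4 : ∫⁻ r in Ioi (0 : ℝ), ENNReal.ofReal (layerProfile s z r) =
      ∫⁻ r, ENNReal.ofReal (layerProfile s z r) := by
    rw [← lintegral_indicator measurableSet_Ioi]
    congr 1; ext r
    by_cases hr : r ∈ Ioi (0 : ℝ)
    · rw [indicator_of_mem hr]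
    · rw [indicator_of_notMem hr, layerProfile, indicator_of_notMem hr, ENNReal.ofReal_zero]
  rw [h4, lintegral_layerProfile s hz he, hG]
  by_cases hzS : z ∈ S
  · simp [hzS, mul_comm]
  · simp [hzS]

lemma densityMeasure_ae_norm_le : ∀ᵐ z ∂densityMeasure n, ‖z‖ ≤ 1 := by
  rw [densityMeasure, ae_withDensity_iff density_continuous.measurable.ennreal_ofReal]
  refine Eventually.of_forall fun z hz => ?_
  by_contra h
  exact hz (by rw [density_eq_zero (not_le.1 h).le, ENNReal.ofReal_zero])

lemma min_one_sq_smul_le {r : ℝ} {z : En n} (hz : ‖z‖ ≤ 1) :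
    min 1 (‖r • z‖ ^ 2) ≤ min 1 (r ^ 2) := by
  refine min_le_min_left _ ?_
  rw [norm_smul, mul_pow, Real.norm_eq_abs, sq_abs]
  exact mul_le_of_le_one_right (sq_nonneg r) (pow_le_one₀ (norm_nonneg _) hz)

/-- Integration against the jump measure is an average over scales. -/
lemma layer_formula (hn : 0 < n) {s : ℝ} (hs : s ∈ Ioo (0 : ℝ) 1) :
    ∃ κ : ℝ, 0 < κ ∧ ∀ (G : En n → ℝ) (C : ℝ), Measurable G →
      (∀ z, |G z| ≤ C * min 1 (‖z‖ ^ 2)) →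
        Integrable G (jumpMeasure n s) ∧
          ∫ r, (∫ z, density n z * G (r • z)) ∂scaleMeasure s = κ * ∫ z, G z ∂jumpMeasure n s := by
  obtain ⟨κ, hκ0, hκ, hmap⟩ := exists_map_smul_eq_jumpMeasure hn hs.1
  refine ⟨κ.toReal, ENNReal.toReal_pos hκ0 hκ, fun G C hG hC => ?_⟩
  have hsm : Measurable fun p : ℝ × En n => p.1 • p.2 := by fun_prop
  have hC0 : 0 ≤ C := by
    have : Nonempty (Fin n) := ⟨⟨0, hn⟩⟩
    obtain ⟨e, he⟩ := exists_norm_eq (En n) zero_le_one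
    have := (abs_nonneg _).trans (hC e)
    simpa [he] using this
  have hGs : Measurable fun p : ℝ × En n => G (p.1 • p.2) := hG.comp hsm
  have hz : ∀ᵐ p ∂(scaleMeasure s).prod (densityMeasure n), ‖p.2‖ ≤ 1 :=
    Measure.quasiMeasurePreserving_snd.ae densityMeasure_ae_norm_le
  have hI : Integrable (fun p : ℝ × En n => G (p.1 • p.2))
      ((scaleMeasure s).prod (densityMeasure n)) := by
    refine Integrable.mono' (((integrable_min_scaleMeasure hs).const_mul C).comp_fst
      (densityMeasure n)) hGs.aestronglyMeasurable ?_
    filter_upwards [hz] with p hp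
    exact (hC _).trans (mul_le_mul_of_nonneg_left (min_one_sq_smul_le hp) hC0)
  have hI2 : Integrable G (κ • jumpMeasure n s) := by
    rw [← hmap, integrable_map_measure hG.aestronglyMeasurable hsm.aemeasurable]
    exact hI
  refine ⟨(integrable_smul_measure hκ0 hκ).1 hI2, ?_⟩
  have h1 : ∫ z, G z ∂(κ • jumpMeasure n s) = κ.toReal * ∫ z, G z ∂jumpMeasure n s := by
    rw [integral_smul_measure, smul_eq_mul]
  rw [← h1, ← hmap, integral_map hsm.aemeasurable hG.aestronglyMeasurable, integral_prod _ hI]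
  simp only [integral_densityMeasure]

/-- Second difference. -/
def secDiff (f : En n → ℝ) (x z : En n) : ℝ := 2 * f x - f (x + z) - f (x - z)

lemma measurable_secDiff {f : En n → ℝ} (hf : Measurable f) (x : En n) :
    Measurable (secDiff f x) := by
  have h1 : Measurable fun z => f (x + z) := hf.comp (by fun_prop)
  have h2 : Measurable fun z => f (x - z) := hf.comp (by fun_prop)
  exact (measurable_const.sub h1).sub h2

/-- Bounded measurable functions which are Lipschitz at `x` with quadratically small second
differences. -/
def Tame (f : En n → ℝ) (x : En n) : Prop :=
  BddMeas f ∧ ∃ δ > 0, ∃ C ≥ 0, ∀ z, ‖z‖ < δ →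
    |f (x + z) - f x| ≤ C * ‖z‖ ∧ |secDiff f x z| ≤ C * ‖z‖ ^ 2

lemma exists_secDiff_le {f : En n → ℝ} {x : En n} {δ C B : ℝ} (hδ : 0 < δ) (hC0 : 0 ≤ C)
    (hB : ∀ y, |f y| ≤ B) (hC : ∀ z, ‖z‖ < δ → |secDiff f x z| ≤ C * ‖z‖ ^ 2) (z : En n) :
    |secDiff f x z| ≤ (C + 4 * B + 4 * B / δ ^ 2) * min 1 (‖z‖ ^ 2) := by
  have hB0 : 0 ≤ B := (abs_nonneg _).trans (hB x)
  have h4 : |secDiff f x z| ≤ 4 * B := by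
    have h1 := abs_le.1 (hB x)
    have h2 := abs_le.1 (hB (x + z))
    have h3 := abs_le.1 (hB (x - z))
    rw [secDiff, abs_le]; constructor <;> linarith
  have hd : 0 ≤ 4 * B / δ ^ 2 := by positivity
  rcases le_total 1 (‖z‖ ^ 2) with h1 | h1
  · rw [min_eq_left h1]; linarith
  · rw [min_eq_right h1]
    rcases lt_or_ge ‖z‖ δ with h2 | h2
    · refine (hC z h2).trans (mul_le_mul_of_nonneg_right (by linarith) (sq_nonneg _))
    · refine h4.trans ?_
      have h3 : δ ^ 2 ≤ ‖z‖ ^ 2 := pow_le_pow_left₀ hδ.le h2 2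
      have h5 : 4 * B = 4 * B / δ ^ 2 * δ ^ 2 := by field_simp
      calc 4 * B = 4 * B / δ ^ 2 * δ ^ 2 := h5
        _ ≤ 4 * B / δ ^ 2 * ‖z‖ ^ 2 := mul_le_mul_of_nonneg_left h3 hd
        _ ≤ _ := mul_le_mul_of_nonneg_right (by linarith) (sq_nonneg _)

namespace Tame

lemma exists_bound {f : En n → ℝ} {x : En n} (hf : Tame f x) :
    ∃ C, 0 ≤ C ∧ ∀ z, |secDiff f x z| ≤ C * min 1 (‖z‖ ^ 2) := by
  obtain ⟨⟨-, B, hB⟩, δ, hδ, C, hC0, hC⟩ := hf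
  have hB0 : 0 ≤ B := (abs_nonneg _).trans (hB x)
  exact ⟨_, by positivity, exists_secDiff_le hδ hC0 hB fun z hz => (hC z hz).2⟩

lemma const (c : ℝ) (x : En n) : Tame (fun _ => c) x :=
  ⟨BddMeas.const c, 1, one_pos, 0, le_rfl, fun z _ => by
    simp only [secDiff, sub_self, abs_zero, zero_mul, le_refl, true_and]
    rw [show 2 * c - c - c = 0 by ring, abs_zero]⟩

lemma add {f g : En n → ℝ} {x : En n} (hf : Tame f x) (hg : Tame g x) :
    Tame (fun y => f y + g y) x := by
  obtain ⟨hfb, δ, hδ, C, hC0, hC⟩ := hf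
  obtain ⟨hgb, δ', hδ', C', hC0', hC'⟩ := hg
  refine ⟨hfb.add hgb, min δ δ', lt_min hδ hδ', C + C', add_nonneg hC0 hC0', fun z hz => ?_⟩
  obtain ⟨a, b⟩ := hC z (hz.trans_le (min_le_left _ _))
  obtain ⟨a', b'⟩ := hC' z (hz.trans_le (min_le_right _ _))
  constructor
  · rw [show f (x + z) + g (x + z) - (f x + g x) = (f (x + z) - f x) + (g (x + z) - g x) by ring,
      add_mul]
    exact (abs_add_le _ _).trans (add_le_add a a')
  · rw [show secDiff (fun y => f y + g y) x z = secDiff f x z + secDiff g x z by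
      simp only [secDiff]; ring, add_mul]
    exact (abs_add_le _ _).trans (add_le_add b b')

lemma mul {f g : En n → ℝ} {x : En n} (hf : Tame f x) (hg : Tame g x) :
    Tame (fun y => f y * g y) x := by
  obtain ⟨hfb, δ, hδ, C, hC0, hC⟩ := hf
  obtain ⟨hgb, δ', hδ', C', hC0', hC'⟩ := hg
  obtain ⟨A, hA⟩ := hfb.2
  obtain ⟨B, hB⟩ := hgb.2
  have hA0 : 0 ≤ A := (abs_nonneg _).trans (hA x)
  have hB0 : 0 ≤ B := (abs_nonneg _).trans (hB x)
  refine ⟨hfb.mul hgb, min δ δ', lt_min hδ hδ', A * C' + B * C + 2 * (C * C'), by positivity,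
    fun z hz => ?_⟩
  obtain ⟨a, b⟩ := hC z (hz.trans_le (min_le_left _ _))
  obtain ⟨a', b'⟩ := hC' z (hz.trans_le (min_le_right _ _))
  obtain ⟨c, -⟩ := hC (-z) (by rw [norm_neg]; exact hz.trans_le (min_le_left _ _))
  obtain ⟨c', -⟩ := hC' (-z) (by rw [norm_neg]; exact hz.trans_le (min_le_right _ _))
  rw [norm_neg, ← sub_eq_add_neg] at c c'
  have hz0 := norm_nonneg z
  constructor
  · rw [show f (x + z) * g (x + z) - f x * g x =
      f (x + z) * (g (x + z) - g x) + g x * (f (x + z) - f x) by ring]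
    refine (abs_add_le _ _).trans ?_
    rw [abs_mul, abs_mul]
    have h1 := mul_le_mul (hA (x + z)) a' (abs_nonneg _) hA0
    have h2 := mul_le_mul (hB x) a (abs_nonneg _) hB0
    nlinarith [mul_nonneg (mul_nonneg hC0 hC0') hz0]
  · have h1 := mul_le_mul (hA x) b' (abs_nonneg _) hA0
    have h2 := mul_le_mul (hB x) b (abs_nonneg _) hB0
    have h3 := mul_le_mul a a' (abs_nonneg _) (by positivity)
    have h4 := mul_le_mul c c' (abs_nonneg _) (by positivity)
    rw [← abs_mul] at h1 h2 h3 h4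
    rw [show secDiff (fun y => f y * g y) x z = f x * secDiff g x z + g x * secDiff f x z +
      -((f (x + z) - f x) * (g (x + z) - g x)) + -((f (x - z) - f x) * (g (x - z) - g x)) by
      simp only [secDiff]; ring]
    refine (abs_add_le _ _).trans ?_
    have h5 := abs_add_le (f x * secDiff g x z + g x * secDiff f x z)
      (-((f (x + z) - f x) * (g (x + z) - g x)))
    have h6 := abs_add_le (f x * secDiff g x z) (g x * secDiff f x z)
    rw [abs_neg] at h5 ⊢
    nlinarith

lemma const_mul (c : ℝ) {f : En n → ℝ} {x : En n} (hf : Tame f x) :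
    Tame (fun y => c * f y) x := (Tame.const c x).mul hf

lemma sq {f : En n → ℝ} {x : En n} (hf : Tame f x) : Tame (fun y => f y ^ 2) x := by
  simpa only [pow_two] using hf.mul hf

/-- Functions with Lipschitz derivative near `x` are tame at `x`. -/
lemma of_fderiv_lipschitz {f : En n → ℝ} {x : En n} {δ M : ℝ} (hfb : BddMeas f) (hδ : 0 < δ)
    (hf : ∀ y ∈ ball x δ, DifferentiableAt ℝ f y)
    (hL : ∀ y ∈ ball x δ, ∀ y' ∈ ball x δ, ‖fderiv ℝ f y - fderiv ℝ f y'‖ ≤ M * ‖y - y'‖) :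
    Tame f x := by
  have hx : x ∈ ball x δ := mem_ball_self hδ
  refine ⟨hfb, δ, hδ, |M| + ‖fderiv ℝ f x‖ + |M| * δ, by positivity, fun z hz => ⟨?_, ?_⟩⟩
  · have hxz : x + z ∈ ball x δ := by simpa [dist_eq_norm] using hz
    have := (convex_ball x δ).norm_image_sub_le_of_norm_fderiv_le (𝕜 := ℝ)
      (C := |M| * δ + ‖fderiv ℝ f x‖) hf (fun y hy => ?_) hx hxz
    · rw [add_sub_cancel_left, Real.norm_eq_abs] at this
      refine this.trans (mul_le_mul_of_nonneg_right ?_ (norm_nonneg _))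
      linarith [abs_nonneg M]
    · have h1 := hL y hy x hx
      have h2 := norm_sub_norm_le (fderiv ℝ f y) (fderiv ℝ f x)
      have h3 : M * ‖y - x‖ ≤ |M| * δ :=
        mul_le_mul (le_abs_self M) (by simpa [dist_eq_norm] using (mem_ball.1 hy).le)
          (norm_nonneg _) (abs_nonneg M)
      linarith
  · refine (abs_second_diff_le hf hL hz).trans (mul_le_mul_of_nonneg_right ?_ (sq_nonneg _))
    have : 0 ≤ |M| * δ := by positivity
    linarith [le_abs_self M, norm_nonneg (fderiv ℝ f x)]

end Tame

lemma measurable_avg {f : En n → ℝ} (hf : Measurable f) (x : En n) :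
    Measurable fun r => avg r f x := by
  have h : Measurable fun p : ℝ × En n => density n p.2 * f (x + p.1 • p.2) :=
    (density_continuous.measurable.comp measurable_snd).mul (hf.comp (by fun_prop))
  exact (h.stronglyMeasurable.integral_prod_right').measurable

lemma abs_sub_avg_le_min {f : En n → ℝ} (hf : BddMeas f) {C r : ℝ} (hC0 : 0 ≤ C) {x : En n}
    (hC : ∀ z, |secDiff f x z| ≤ C * min 1 (‖z‖ ^ 2)) :
    |f x - avg r f x| ≤ C * min 1 (r ^ 2) := by
  have h := abs_sub_avg_le (A := C * min 1 (r ^ 2)) hf (r := r) (x := x) fun z hz =>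
    (hC (r • z)).trans (mul_le_mul_of_nonneg_left (min_one_sq_smul_le hz) hC0)
  have : 0 ≤ C * min 1 (r ^ 2) := mul_nonneg hC0 (le_min zero_le_one (sq_nonneg r))
  linarith

/-- The integrated deviation from averages, a multiple of the fractional Laplacian. -/
def avgLap (s : ℝ) (f : En n → ℝ) (x : En n) : ℝ := ∫ r, (f x - avg r f x) ∂scaleMeasure s

lemma Tame.integrable_sub_avg {f : En n → ℝ} {x : En n} (hf : Tame f x) {s : ℝ}
    (hs : s ∈ Ioo (0 : ℝ) 1) : Integrable (fun r => f x - avg r f x) (scaleMeasure s) := by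
  obtain ⟨C, hC0, hC⟩ := hf.exists_bound
  exact Integrable.mono' ((integrable_min_scaleMeasure hs).const_mul C)
    (measurable_const.sub (measurable_avg hf.1.1 x)).aestronglyMeasurable
    (Eventually.of_forall fun r => abs_sub_avg_le_min hf.1 hC0 hC)

lemma integral_density_mul_secDiff {f : En n → ℝ} (hf : BddMeas f) (r : ℝ) (x : En n) :
    ∫ z, density n z * secDiff f x (r • z) = 2 * (f x - avg r f x) := (sub_avg_eq hf r x).symm

/-- Smooth functions vanishing outside the ball of radius `ε`. -/
def SmoothKernel (ε : ℝ) (ψ : En n → ℝ) : Prop :=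
  ContDiff ℝ (⊤ : ℕ∞) ψ ∧ ∀ y, ε < ‖y‖ → ψ y = 0

namespace SmoothKernel

lemma hasCompactSupport {ε : ℝ} {ψ : En n → ℝ} (hψ : SmoothKernel ε ψ) : HasCompactSupport ψ :=
  HasCompactSupport.intro (isCompact_closedBall 0 ε) fun y hy =>
    hψ.2 y (by simpa using hy)

lemma integrable {ε : ℝ} {ψ : En n → ℝ} (hψ : SmoothKernel ε ψ) : Integrable ψ :=
  hψ.1.continuous.integrable_of_hasCompactSupport hψ.hasCompactSupport

lemma dirDeriv {ε : ℝ} {ψ : En n → ℝ} (hψ : SmoothKernel ε ψ) (e : En n) :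
    SmoothKernel ε fun y => fderiv ℝ ψ y e := by
  refine ⟨(hψ.1.fderiv_right (m := (⊤ : ℕ∞)) (by simp)).clm_apply contDiff_const, fun y hy => ?_⟩
  have h : ψ =ᶠ[nhds y] fun _ => 0 := by
    filter_upwards [(isOpen_lt continuous_const continuous_norm).mem_nhds hy] with z hz
    exact hψ.2 z hz
  simp [h.fderiv_eq]

end SmoothKernel

/-- The convolution of `u` with the kernel `ψ`. -/
def mollify (ψ u : En n → ℝ) (x : En n) : ℝ := ∫ y, ψ y * u (x - y)

lemma BddMeas.integrable_mul_sub {u ψ : En n → ℝ} (hu : BddMeas u) (hψ : Integrable ψ) (x : En n) :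
    Integrable fun y => ψ y * u (x - y) := by
  have h : BddMeas fun y => u (x - y) := hu.comp (by fun_prop)
  exact h.integrable_mul hψ

lemma abs_mollify_le {u ψ : En n → ℝ} {B : ℝ} (hB : ∀ x, |u x| ≤ B) (hψ : Integrable ψ) (x : En n) :
    |mollify ψ u x| ≤ (∫ y, |ψ y|) * B := by
  rw [mollify, ← integral_mul_const, ← Real.norm_eq_abs]
  refine norm_integral_le_of_norm_le (hψ.abs.mul_const B) (Eventually.of_forall fun y => ?_)
  rw [Real.norm_eq_abs, abs_mul]
  exact mul_le_mul_of_nonneg_left (hB _) (abs_nonneg _)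

lemma abs_mollify_sub_le {u ψ : En n → ℝ} {L : ℝ≥0} (hub : BddMeas u) (hu : LipschitzWith L u)
    (hψ : Integrable ψ) (x x' : En n) :
    |mollify ψ u x - mollify ψ u x'| ≤ (∫ y, |ψ y|) * L * ‖x - x'‖ := by
  rw [mollify, mollify, ← integral_sub (hub.integrable_mul_sub hψ x) (hub.integrable_mul_sub hψ x'),
    mul_assoc, ← integral_mul_const, ← Real.norm_eq_abs]
  refine norm_integral_le_of_norm_le (hψ.abs.mul_const _) (Eventually.of_forall fun y => ?_)
  rw [Real.norm_eq_abs, ← mul_sub, abs_mul]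
  refine mul_le_mul_of_nonneg_left ?_ (abs_nonneg _)
  have := hu.dist_le_mul (x - y) (x' - y)
  rwa [dist_eq_norm, dist_eq_norm, sub_sub_sub_cancel_right, Real.norm_eq_abs] at this

lemma lipschitzWith_mollify {u ψ : En n → ℝ} {L : ℝ≥0} (hub : BddMeas u) (hu : LipschitzWith L u)
    (hψ : Integrable ψ) : LipschitzWith (Real.toNNReal (∫ y, |ψ y|) * L) (mollify ψ u) := by
  refine LipschitzWith.of_dist_le_mul fun x x' => ?_
  rw [dist_eq_norm, dist_eq_norm, Real.norm_eq_abs, NNReal.coe_mul,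
    Real.coe_toNNReal _ (integral_nonneg fun _ => abs_nonneg _)]
  exact abs_mollify_sub_le hub hu hψ x x'

section Smooth

variable {u ψ : En n → ℝ} {L : ℝ≥0} {ε : ℝ}

lemma contDiff_mollify (hu : LipschitzWith L u) (hψ : SmoothKernel ε ψ) :
    ContDiff ℝ (⊤ : ℕ∞) (mollify ψ u) :=
  hψ.hasCompactSupport.contDiff_convolution_left (ContinuousLinearMap.lsmul ℝ ℝ) hψ.1
    hu.continuous.locallyIntegrable

lemma bddMeas_mollify (hub : BddMeas u) (hu : LipschitzWith L u) (hψ : SmoothKernel ε ψ) :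
    BddMeas (mollify ψ u) :=
  ⟨(contDiff_mollify hu hψ).continuous.measurable, by
    obtain ⟨-, B, hB⟩ := hub
    exact ⟨_, abs_mollify_le hB hψ.integrable⟩⟩

lemma fderiv_mollify (hu : LipschitzWith L u) (hψ : SmoothKernel ε ψ) (x e : En n) :
    fderiv ℝ (mollify ψ u) x e = mollify (fun y => fderiv ℝ ψ y e) u x := by
  have h := hψ.hasCompactSupport.hasFDerivAt_convolution_left (ContinuousLinearMap.lsmul ℝ ℝ)
    (hψ.1.of_le (by exact_mod_cast le_top)) (hu.continuous.locallyIntegrable (μ := volume)) x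
  have h1 : HasFDerivAt (mollify ψ u) _ x := h
  rw [h1.fderiv, convolution_def, ContinuousLinearMap.integral_apply]
  · rfl
  · have hc : Continuous (fderiv ℝ ψ) := hψ.1.continuous_fderiv (by simp)
    have hs : HasCompactSupport (fderiv ℝ ψ) := hψ.hasCompactSupport.fderiv ℝ
    exact hs.convolutionExists_left _ hc hu.continuous.locallyIntegrable x

lemma fderiv_mollify_lipschitz (hub : BddMeas u) (hu : LipschitzWith L u) (hψ : SmoothKernel ε ψ)
    (x x' : En n) : ‖fderiv ℝ (mollify ψ u) x - fderiv ℝ (mollify ψ u) x'‖ ≤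
      (∫ y, ‖fderiv ℝ ψ y‖) * L * ‖x - x'‖ := by
  have hI : 0 ≤ ∫ y, ‖fderiv ℝ ψ y‖ := integral_nonneg fun _ => norm_nonneg _
  refine ContinuousLinearMap.opNorm_le_bound _ (by positivity) fun e => ?_
  rw [sub_apply, fderiv_mollify hu hψ, fderiv_mollify hu hψ, Real.norm_eq_abs]
  refine (abs_mollify_sub_le hub hu (hψ.dirDeriv e).integrable x x').trans ?_
  have hc : Continuous (fderiv ℝ ψ) := hψ.1.continuous_fderiv (by simp)
  have hs : HasCompactSupport (fderiv ℝ ψ) := hψ.hasCompactSupport.fderiv ℝ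
  have hintg : Integrable (fderiv ℝ ψ) := hc.integrable_of_hasCompactSupport hs
  have h : ∫ y, |fderiv ℝ ψ y e| ≤ (∫ y, ‖fderiv ℝ ψ y‖) * ‖e‖ := by
    rw [← integral_mul_const]
    refine integral_mono (hψ.dirDeriv e).integrable.abs (hintg.norm.mul_const _) fun y => ?_
    simpa using (fderiv ℝ ψ y).le_opNorm e
  calc (∫ y, |fderiv ℝ ψ y e|) * L * ‖x - x'‖
      ≤ (∫ y, ‖fderiv ℝ ψ y‖) * ‖e‖ * L * ‖x - x'‖ := by gcongr
    _ = _ := by ring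

lemma tame_mollify (hub : BddMeas u) (hu : LipschitzWith L u) (hψ : SmoothKernel ε ψ) (x : En n) :
    Tame (mollify ψ u) x :=
  Tame.of_fderiv_lipschitz (bddMeas_mollify hub hu hψ) one_pos
    (fun y _ => (contDiff_mollify hu hψ).differentiable (by simp) y)
    (fun y _ y' _ => fderiv_mollify_lipschitz hub hu hψ y y')

lemma integral_shift_mul (ψ : En n → ℝ) (x₀ z : En n) :
    ∫ x, ψ (x₀ - x) * u (x + z) = mollify ψ u (x₀ + z) := by
  rw [mollify, ← integral_sub_left_eq_self (fun y => ψ y * u (x₀ + z - y)) volume x₀]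
  congr 1; ext x
  congr 2; abel

/-- The mixed difference integral of the weak formulation is a second difference of a
mollification. -/
lemma integral_mixed_diff (hub : BddMeas u) (hψ : SmoothKernel ε ψ) (x₀ z : En n) :
    ∫ x, (u x - u (x + z)) * (ψ (x₀ - x) - ψ (x₀ - (x + z))) = secDiff (mollify ψ u) x₀ z := by
  have hi : ∀ a b : En n, Integrable fun x => ψ (a - x) * u (x + b) := fun a b => by
    have h1 : Integrable fun x => ψ (a - x) := hψ.integrable.comp_sub_left a
    have h2 : BddMeas fun x => u (x + b) := hub.comp (by fun_prop)
    exact h2.integrable_mul h1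
  have e1 := integral_shift_mul (u := u) ψ x₀ 0
  have e2 := integral_shift_mul (u := u) ψ x₀ z
  have e3 := integral_shift_mul (u := u) ψ (x₀ - z) 0
  have e4 := integral_shift_mul (u := u) ψ (x₀ - z) z
  have i1 := hi x₀ 0
  have i2 := hi x₀ z
  have i3 := hi (x₀ - z) 0
  have i4 := hi (x₀ - z) z
  simp only [add_zero] at e1 e3 i1 i3
  rw [sub_add_cancel] at e4
  have : ∀ x, (u x - u (x + z)) * (ψ (x₀ - x) - ψ (x₀ - (x + z))) =
      ψ (x₀ - x) * u x + ψ (x₀ - z - x) * u (x + z) - (ψ (x₀ - x) * u (x + z) +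
        ψ (x₀ - z - x) * u x) := fun x => by
    rw [show x₀ - (x + z) = x₀ - z - x by abel]; ring
  simp only [this]
  have j1 : Integrable fun x => ψ (x₀ - x) * u x + ψ (x₀ - z - x) * u (x + z) := i1.add i4
  have j2 : Integrable fun x => ψ (x₀ - x) * u (x + z) + ψ (x₀ - z - x) * u x := i2.add i3
  rw [integral_sub j1 j2, integral_add i1 i4, integral_add i2 i3, e1, e2, e3, e4, secDiff]
  ring

end Smooth

lemma integrable_min_jump (hn : 0 < n) {s : ℝ} (hs : s ∈ Ioo (0 : ℝ) 1) :
    Integrable fun z : En n => ‖z‖ ^ (-((n : ℝ) + 2 * s)) * min 1 (‖z‖ ^ 2) := by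
  obtain ⟨κ, hκ, h⟩ := layer_formula hn hs
  have h1 := (h (fun z : En n => min 1 (‖z‖ ^ 2)) 1 (by fun_prop) fun z => by
    rw [one_mul, abs_of_nonneg (le_min zero_le_one (sq_nonneg _))]).1
  rw [jumpMeasure, integrable_withDensity_iff_integrable_smul' (by fun_prop) (by simp)] at h1
  refine h1.congr (Eventually.of_forall fun z => ?_)
  simp only [ENNReal.toReal_ofReal (Real.rpow_nonneg (norm_nonneg z) _), smul_eq_mul]

/-- Mollifications of a weak solution are solutions away from the boundary. -/
lemma avgLap_mollify_eq_zero (hn : 0 < n) {s : ℝ} (hs : s ∈ Ioo (0 : ℝ) 1) {u ψ : En n → ℝ}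
    {L : ℝ≥0} {ε : ℝ} (hub : BddMeas u) (hu : LipschitzWith L u)
    (hw : IsWeakSHarmonicInB1 n s u) (hψ : SmoothKernel ε ψ) {x₀ : En n} (hx₀ : ‖x₀‖ + ε < 1) :
    avgLap s (mollify ψ u) x₀ = 0 := by
  set φ : En n → ℝ := fun y => ψ (x₀ - y) with hφ
  have hφd : ContDiff ℝ (⊤ : ℕ∞) φ := hψ.1.comp (contDiff_const.sub contDiff_id)
  have hφ0 : ∀ y ∉ closedBall x₀ ε, φ y = 0 := fun y hy =>
    hψ.2 _ (by rwa [mem_closedBall, dist_comm, dist_eq_norm, not_le] at hy)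
  have hφs : HasCompactSupport φ := HasCompactSupport.intro (isCompact_closedBall x₀ ε) hφ0
  have hφt : tsupport φ ⊆ closedBall x₀ ε :=
    closure_minimal (fun y hy => by_contra fun h => hy (hφ0 y h)) isClosed_closedBall
  have hball : closedBall x₀ ε ⊆ ball 0 1 := fun y hy => by
    rw [mem_closedBall, dist_eq_norm] at hy
    have := norm_add_le (y - x₀) x₀
    rw [sub_add_cancel] at this
    rw [mem_ball_zero_iff]; linarith
  have hweak := hw φ hφd hφs (hφt.trans hball)
  have hmp := measurePreserving_prod_add (volume : Measure (En n)) (volume : Measure (En n))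
  have hcv := hmp.integral_comp (MeasurableEquiv.shearAddRight (En n)).measurableEmbedding
    (fun p : En n × En n =>
        (u p.1 - u p.2) * (φ p.1 - φ p.2) * ‖p.1 - p.2‖ ^ (-((n:ℝ) + 2*s)))
  rw [← Measure.volume_eq_prod, hweak] at hcv
  simp only [sub_add_cancel_left, norm_neg] at hcv
  obtain ⟨B, hB⟩ := hub.2
  have hB0 : 0 ≤ B := (abs_nonneg _).trans (hB 0)
  obtain ⟨-, B', hB'⟩ := bddMeas_of_hasCompactSupport hφd.continuous hφs
  have hB'0 : 0 ≤ B' := (abs_nonneg _).trans (hB' 0)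
  obtain ⟨L', hL'⟩ :=
    (hφd.of_le (by exact_mod_cast le_top : (1 : WithTop ℕ∞) ≤ _)).lipschitzWith_of_hasCompactSupport
      hφs (by simp)
  set C : ℝ := 2 * B * (2 * B') + L * L' with hC
  have hbd : ∀ x z : En n, |(u x - u (x + z)) * (φ x - φ (x + z))| ≤ C * min 1 (‖z‖ ^ 2) := by
    intro x z
    rw [abs_mul]
    have hLL : (0 : ℝ) ≤ L * L' := by positivity
    have hBB : 0 ≤ 2 * B * (2 * B') := by positivity
    rcases le_total 1 (‖z‖ ^ 2) with h1 | h1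
    · rw [min_eq_left h1]
      have h2 : |u x - u (x + z)| ≤ 2 * B := (abs_sub _ _).trans (by linarith [hB x, hB (x + z)])
      have h3 : |φ x - φ (x + z)| ≤ 2 * B' :=
        (abs_sub _ _).trans (by linarith [hB' x, hB' (x + z)])
      have := mul_le_mul h2 h3 (abs_nonneg _) (by positivity)
      linarith
    · rw [min_eq_right h1]
      have h2 := hu.dist_le_mul x (x + z)
      have h3 := hL'.dist_le_mul x (x + z)
      rw [dist_eq_norm, dist_self_add_right, Real.norm_eq_abs] at h2 h3
      have := mul_le_mul h2 h3 (abs_nonneg _) (by positivity)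
      nlinarith [sq_nonneg ‖z‖]
  set I : En n → ℝ := (closedBall x₀ ε).indicator 1 with hI
  have hI0 : ∀ y, 0 ≤ I y := fun y => indicator_nonneg (fun _ _ => zero_le_one) y
  have hIi : Integrable I :=
    (integrable_indicator_iff measurableSet_closedBall).2
      (integrableOn_const (isCompact_closedBall x₀ ε).measure_lt_top.ne)
  have hsupp : ∀ x z : En n, |(u x - u (x + z)) * (φ x - φ (x + z))| ≤
      C * min 1 (‖z‖ ^ 2) * (I x + I (x + z)) := by
    intro x z
    have hp := (abs_nonneg _).trans (hbd x z)
    by_cases h1 : x ∈ closedBall x₀ ε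
    · have : I x = 1 := by rw [hI, indicator_of_mem h1]; rfl
      refine (hbd x z).trans (le_mul_of_one_le_right hp ?_)
      linarith [hI0 (x + z)]
    · by_cases h2 : x + z ∈ closedBall x₀ ε
      · have : I (x + z) = 1 := by rw [hI, indicator_of_mem h2]; rfl
        refine (hbd x z).trans (le_mul_of_one_le_right hp ?_)
        linarith [hI0 x]
      · rw [hφ0 _ h1, hφ0 _ h2, sub_self, mul_zero, abs_zero]
        exact mul_nonneg hp (add_nonneg (hI0 _) (hI0 _))
  have hK := integrable_min_jump hn hs
  have hI1 : Integrable (fun p : En n × En n =>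
      I p.1 * (‖p.2‖ ^ (-((n : ℝ) + 2 * s)) * min 1 (‖p.2‖ ^ 2))) (volume.prod volume) :=
    hIi.mul_prod hK
  have hI2 : Integrable (fun p : En n × En n =>
      I (p.1 + p.2) * (‖p.2‖ ^ (-((n : ℝ) + 2 * s)) * min 1 (‖p.2‖ ^ 2))) (volume.prod volume) := by
    have h := (measurePreserving_prod_add_swap (volume : Measure (En n))
      (volume : Measure (En n))).integrable_comp_of_integrable (hK.mul_prod hIi)
    refine h.congr (Eventually.of_forall fun p => ?_)
    simp only [Function.comp_apply, add_comm p.2]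
    ring
  have hintg : Integrable (fun p : En n × En n => (u p.1 - u (p.1 + p.2)) *
      (φ p.1 - φ (p.1 + p.2)) * ‖p.2‖ ^ (-((n:ℝ) + 2*s))) (volume.prod volume) := by
    refine Integrable.mono' ((hI1.add hI2).const_mul C) ?_ (Eventually.of_forall fun p => ?_)
    · have hum := hub.1
      have hφm := hφd.continuous.measurable
      have : Measurable (fun p : En n × En n => (u p.1 - u (p.1 + p.2)) *
        (φ p.1 - φ (p.1 + p.2)) * ‖p.2‖ ^ (-((n:ℝ) + 2*s))) := by fun_prop
      exact this.aestronglyMeasurable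
    · have hk : 0 ≤ ‖p.2‖ ^ (-((n:ℝ) + 2*s)) := Real.rpow_nonneg (norm_nonneg _) _
      rw [Real.norm_eq_abs, abs_mul, abs_of_nonneg hk]
      refine (mul_le_mul_of_nonneg_right (hsupp p.1 p.2) hk).trans (le_of_eq ?_)
      simp only [Pi.add_apply]
      ring
  rw [Measure.volume_eq_prod, integral_prod_symm _ hintg] at hcv
  simp only [integral_mul_const, hφ, integral_mixed_diff hub hψ] at hcv
  have hT := tame_mollify hub hu hψ x₀
  obtain ⟨C', -, hC'⟩ := hT.exists_bound
  obtain ⟨κ, hκ, hlayer⟩ := layer_formula hn hs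
  have h := (hlayer (secDiff (mollify ψ u) x₀) C' (measurable_secDiff hT.1.1 x₀) hC').2
  simp only [integral_density_mul_secDiff hT.1] at h
  rw [integral_const_mul, integral_jumpMeasure] at h
  have h0 : ∫ z : En n, ‖z‖ ^ (-((n : ℝ) + 2 * s)) * secDiff (mollify ψ u) x₀ z = 0 := by
    rw [← hcv]; congr 1; ext z; rw [mul_comm]
  rw [h0, mul_zero] at h
  exact (mul_eq_zero.1 h).resolve_left two_ne_zero

lemma integrableOn_const_scaleMeasure {s : ℝ} (hs : s ∈ Ioo (0 : ℝ) 1) {R : ℝ} (hR : 0 < R)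
    (c : ℝ) : IntegrableOn (fun _ => c) (Ioi R) (scaleMeasure s) := by
  have hm : 0 < min 1 (R ^ 2) := lt_min one_pos (by positivity)
  refine Integrable.mono' (((integrable_min_scaleMeasure hs).const_mul
    (|c| / min 1 (R ^ 2))).integrableOn) aestronglyMeasurable_const ?_
  filter_upwards [ae_restrict_mem measurableSet_Ioi] with r hr
  rw [Real.norm_eq_abs, div_mul_eq_mul_div, le_div_iff₀ hm]
  refine mul_le_mul_of_nonneg_left (min_le_min_left _ ?_) (abs_nonneg c)
  exact pow_le_pow_left₀ hR.le (mem_Ioi.1 hr).le 2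

lemma scaleMeasure_Ioi_ne_top {s : ℝ} (hs : s ∈ Ioo (0 : ℝ) 1) {R : ℝ} (hR : 0 < R) :
    scaleMeasure s (Ioi R) ≠ ⊤ := by
  have h := integrableOn_const_scaleMeasure hs hR 1
  rw [IntegrableOn, integrable_const_iff_isFiniteMeasure one_ne_zero] at h
  have := h.measure_univ_lt_top
  rw [Measure.restrict_apply_univ] at this
  exact this.ne

lemma scaleMeasure_real_Ioi_pos {s : ℝ} (hs : s ∈ Ioo (0 : ℝ) 1) {R : ℝ} (hR : 0 < R) :
    0 < (scaleMeasure s).real (Ioi R) := by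
  refine ENNReal.toReal_pos (fun h0 => ?_) (scaleMeasure_Ioi_ne_top hs hR)
  rw [scaleMeasure, withDensity_apply_eq_zero (by fun_prop),
    Measure.restrict_apply' measurableSet_Ioi] at h0
  have h1 : Ioi R ⊆ {r : ℝ | ENNReal.ofReal (r ^ (-1 - 2 * s)) ≠ 0} ∩ Ioi R ∩ Ioi 0 := by
    intro r hr
    have hr0 : 0 < r := hR.trans hr
    refine ⟨⟨?_, hr⟩, hr0⟩
    simpa using Real.rpow_pos_of_pos hr0 _
  have h2 := measure_mono_null h1 h0
  simp at h2

/-- For solutions, the contribution of small scales is controlled by the tail. -/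
lemma exists_setIntegral_Iic_eq {s : ℝ} (hs : s ∈ Ioo (0 : ℝ) 1) {g : En n → ℝ} {x : En n}
    (hg : Tame g x) (h0 : avgLap s g x = 0) {R T : ℝ} (hR : 0 < R)
    (hT : ∀ r, R < r → |avg r g x| ≤ T) :
    ∃ t, |t| ≤ T ∧ ∫ r in Iic R, (g x - avg r g x) ∂scaleMeasure s =
      (scaleMeasure s).real (Ioi R) * (t - g x) := by
  set a := (scaleMeasure s).real (Ioi R) with ha
  have ha0 : 0 < a := scaleMeasure_real_Ioi_pos hs hR
  have hi := hg.integrable_sub_avg hs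
  have hsplit := integral_add_compl (measurableSet_Iic (a := R)) hi
  rw [compl_Iic] at hsplit
  have hiA : IntegrableOn (fun r => avg r g x) (Ioi R) (scaleMeasure s) := by
    have := (integrableOn_const_scaleMeasure hs hR (g x)).sub hi.integrableOn
    refine this.congr (Eventually.of_forall fun r => ?_)
    simp
  have hb : |∫ r in Ioi R, avg r g x ∂scaleMeasure s| ≤ T * a := by
    rw [← Real.norm_eq_abs]
    refine norm_setIntegral_le_of_norm_le_const (scaleMeasure_Ioi_ne_top hs hR).lt_top
      fun r hr => hT r hr
  have htail : ∫ r in Ioi R, (g x - avg r g x) ∂scaleMeasure s =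
      a * g x - ∫ r in Ioi R, avg r g x ∂scaleMeasure s := by
    rw [integral_sub (integrableOn_const_scaleMeasure hs hR (g x)) hiA, setIntegral_const,
      smul_eq_mul]
  refine ⟨(∫ r in Ioi R, avg r g x ∂scaleMeasure s) / a, ?_, ?_⟩
  · rwa [abs_div, abs_of_pos ha0, div_le_iff₀ ha0]
  · have : avgLap s g x = ∫ r, (g x - avg r g x) ∂scaleMeasure s := rfl
    rw [← this, h0, htail] at hsplit
    rw [mul_sub, mul_div_cancel₀ _ ha0.ne']
    linarith

lemma avg_le_of_forall_le {F : En n → ℝ} (hF : BddMeas F) {r c : ℝ} {x : En n}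
    (h : ∀ z, ‖z‖ ≤ 1 → F (x + r • z) ≤ c) : avg r F x ≤ c := by
  have h1 : avg r F x ≤ ∫ z, density n z * c := by
    refine integral_mono ((hF.comp_affine x r).integrable_mul density_integrable)
      (density_integrable.mul_const c) fun z => ?_
    by_cases hz : ‖z‖ ≤ 1
    · exact mul_le_mul_of_nonneg_left (h z hz) (density_nonneg z)
    · simp [density_eq_zero (not_le.1 hz).le]
  rwa [integral_mul_const, density_integral, one_mul] at h1

lemma exists_c2BddBy {η : En n → ℝ} (hη : ContDiff ℝ 2 η) (hs : HasCompactSupport η) :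
    ∃ M, C2BddBy n η M := by
  have h1 : ContDiff ℝ 1 (fderiv ℝ η) := hη.fderiv_right (by norm_num)
  have hs1 : HasCompactSupport (fderiv ℝ η) := hs.fderiv ℝ
  have hA : ∃ A, ∀ x, ‖η x‖ ≤ A := hs.exists_bound_of_continuous hη.continuous
  have hB : ∃ A, ∀ x, ‖fderiv ℝ η x‖ ≤ A := hs1.exists_bound_of_continuous h1.continuous
  obtain ⟨C, hC⟩ := h1.lipschitzWith_of_hasCompactSupport hs1 (by simp)
  obtain ⟨A, hA⟩ := hA
  obtain ⟨B, hB⟩ := hB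
  refine ⟨max A (max B (C : ℝ)), fun x => ?_⟩
  have k1 : B ≤ max A (max B (C : ℝ)) := (le_max_left B C).trans (le_max_right _ _)
  have k2 : (C : ℝ) ≤ max A (max B (C : ℝ)) := (le_max_right B _).trans (le_max_right _ _)
  exact ⟨(hA x).trans (le_max_left _ _), (hB x).trans k1, (norm_fderiv_le_of_lipschitz ℝ hC).trans k2⟩

/-- Interior derivative estimate, with constants independent of the solution. -/
lemma exists_interior_estimate (x₀ : En n) {ρ : ℝ} (hρ : 0 < ρ) :
    ∃ K : ℝ, 0 ≤ K ∧ ∀ (s : ℝ), s ∈ Ioo (0 : ℝ) 1 → ∀ (w : En n → ℝ) (L : ℝ≥0) (e : En n)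
      (A T : ℝ), ContDiff ℝ 1 w → BddMeas w → LipschitzWith L w → ‖e‖ ≤ 1 →
      (∀ y ∈ closedBall x₀ ρ, Tame w y ∧ Tame (fun y => fderiv ℝ w y e) y ∧ avgLap s w y = 0 ∧
        avgLap s (fun y => fderiv ℝ w y e) y = 0 ∧ |w y| ≤ A ∧
        ∀ r, ρ / 4 < r → |avg r w y| ≤ T ∧ |avg r (fun y => fderiv ℝ w y e) y| ≤ T) →
      ∀ x ∈ closedBall x₀ (ρ / 2), |fderiv ℝ w x e| ≤ K * (A + T) := by
  set η : ContDiffBump x₀ := ⟨ρ / 2, 3 * ρ / 4, by linarith, by linarith⟩ with hη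
  have hηd : ContDiff ℝ 2 (η : En n → ℝ) := η.contDiff
  obtain ⟨M, hM⟩ := exists_c2BddBy hηd η.hasCompactSupport
  set σ := bernsteinConst n * M ^ 2 with hσ
  have hσ0 : 0 ≤ σ := mul_nonneg bernsteinConst_nonneg (sq_nonneg M)
  refine ⟨1 + σ, by linarith, fun s hs w L e A T hw hwb hwL he h x hx => ?_⟩
  set v : En n → ℝ := fun y => fderiv ℝ w y e with hv
  set F := bernstein η w σ e with hF
  have hvc : Continuous v := (hw.continuous_fderiv (by simp)).clm_apply continuous_const
  have hFc : Continuous F :=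
    ((hηd.continuous.pow 2).mul (hvc.pow 2)).add (continuous_const.mul (hw.continuous.pow 2))
  have hFb : BddMeas F := bddMeas_bernstein hwb hwL (c2BddBy_bddMeas hηd hM) σ e
  have hx₀ : x₀ ∈ closedBall x₀ ρ := mem_closedBall_self hρ.le
  have hA0 : 0 ≤ A := (abs_nonneg _).trans (h x₀ hx₀).2.2.2.2.1
  have hT0 : 0 ≤ T := (abs_nonneg _).trans ((h x₀ hx₀).2.2.2.2.2 ρ (by linarith)).1
  obtain ⟨x₁, hx₁, hmax⟩ := (isCompact_closedBall x₀ ρ).exists_isMaxOn ⟨x₀, hx₀⟩ hFc.continuousOn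
  have hFx₁ : F x₁ ≤ σ * A ^ 2 + (1 + σ) * T ^ 2 := by
    obtain ⟨tw, tv, lw, lv, hA, hT⟩ := h x₁ hx₁
    by_cases hb : x₁ ∈ closedBall x₀ (3 * ρ / 4)
    · obtain ⟨t, ht, hti⟩ := exists_setIntegral_Iic_eq hs tv lv (R := ρ / 4) (by linarith)
        (fun r hr => (hT r hr).2)
      obtain ⟨t', ht', hti'⟩ := exists_setIntegral_Iic_eq hs tw lw (R := ρ / 4) (by linarith)
        (fun r hr => (hT r hr).1)
      have ha0 := scaleMeasure_real_Ioi_pos hs (R := ρ / 4) (by linarith)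
      set a := (scaleMeasure s).real (Ioi (ρ / 4))
      have i1 := ((tv.integrable_sub_avg hs).integrableOn (s := Iic (ρ / 4))).const_mul
        (2 * η x₁ ^ 2 * v x₁)
      have i2 := ((tw.integrable_sub_avg hs).integrableOn (s := Iic (ρ / 4))).const_mul
        (2 * σ * w x₁)
      have hpos : 0 ≤ ∫ r in Iic (ρ / 4), (2 * η x₁ ^ 2 * v x₁ * (v x₁ - avg r v x₁) +
          2 * σ * w x₁ * (w x₁ - avg r w x₁)) ∂scaleMeasure s := by
        refine integral_nonneg_of_ae ?_
        filter_upwards [ae_restrict_of_ae (scaleMeasure_ae_pos s),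
          ae_restrict_mem measurableSet_Iic] with r hr0 hr
        have h1 := bernstein_sub_avg_le hwb hwL hηd hM he le_rfl hr0 x₁
        refine le_trans (sub_nonneg.2 ?_) h1
        refine avg_le_of_forall_le hFb fun z hz => hmax ?_
        rw [mem_closedBall, dist_eq_norm] at hb ⊢
        have h2 : ‖r • z‖ ≤ ρ / 4 := by
          rw [norm_smul, Real.norm_of_nonneg hr0.le]
          exact (mul_le_of_le_one_right hr0.le hz).trans hr
        have h3 := norm_add_le (x₁ - x₀) (r • z)
        rw [show x₁ + r • z - x₀ = x₁ - x₀ + r • z by abel]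
        linarith
      rw [integral_add i1 i2, integral_const_mul, integral_const_mul, hti, hti'] at hpos
      have h2 : 0 ≤ η x₁ ^ 2 * v x₁ * (t - v x₁) + σ * w x₁ * (t' - w x₁) := by
        refine nonneg_of_mul_nonneg_right (a := 2 * a) ?_ (by positivity)
        refine hpos.trans (le_of_eq ?_)
        ring
      have hη1 : η x₁ ^ 2 ≤ 1 := pow_le_one₀ η.nonneg η.le_one
      have ht2 : t ^ 2 ≤ T ^ 2 := sq_le_sq.2 (by rwa [abs_of_nonneg hT0])
      have ht2' : t' ^ 2 ≤ T ^ 2 := sq_le_sq.2 (by rwa [abs_of_nonneg hT0])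
      have hFe : F x₁ = η x₁ ^ 2 * v x₁ ^ 2 + σ * w x₁ ^ 2 := rfl
      have k1 : η x₁ ^ 2 * t ^ 2 ≤ T ^ 2 :=
        (mul_le_of_le_one_left (sq_nonneg t) hη1).trans ht2
      have k2 := mul_le_mul_of_nonneg_left ht2' hσ0
      have k3 := mul_nonneg (sq_nonneg (η x₁)) (sq_nonneg (v x₁ - t))
      have k4 := mul_nonneg hσ0 (sq_nonneg (w x₁ - t'))
      have k5 := mul_nonneg hσ0 (sq_nonneg A)
      nlinarith
    · have h0 : η x₁ = 0 := η.zero_of_le_dist (not_le.1 hb).le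
      have hFe : F x₁ = η x₁ ^ 2 * v x₁ ^ 2 + σ * w x₁ ^ 2 := rfl
      rw [hFe, h0]
      have : w x₁ ^ 2 ≤ A ^ 2 := sq_le_sq.2 (by rwa [abs_of_nonneg hA0])
      have := mul_le_mul_of_nonneg_left this hσ0
      nlinarith [sq_nonneg T]
  have hFx : F x ≤ F x₁ := hmax (closedBall_subset_closedBall (by linarith) hx)
  have h1 : η x = 1 := η.one_of_mem_closedBall hx
  have hFe : F x = η x ^ 2 * v x ^ 2 + σ * w x ^ 2 := rfl
  have hvx : v x ^ 2 ≤ ((1 + σ) * (A + T)) ^ 2 := by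
    rw [hFe, h1] at hFx
    have k1 := mul_nonneg hσ0 (sq_nonneg (w x))
    have k2 : σ * A ^ 2 + (1 + σ) * T ^ 2 ≤ (1 + σ) * (A + T) ^ 2 := by
      nlinarith [mul_nonneg hA0 hT0, mul_nonneg hσ0 (mul_nonneg hA0 hT0), sq_nonneg A]
    have k3 : (1 + σ) * (A + T) ^ 2 ≤ ((1 + σ) * (A + T)) ^ 2 := by
      rw [mul_pow]
      exact mul_le_mul_of_nonneg_right (by nlinarith) (sq_nonneg _)
    linarith
  exact abs_le_of_sq_le_sq hvx (by positivity)

lemma abs_integral_mul_le_of_support {ψ f : En n → ℝ} {M B : ℝ} (hψ : ∀ z, |ψ z| ≤ M)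
    (hψ0 : ∀ z, 1 < ‖z‖ → ψ z = 0) (hf : ∀ z, |f z| ≤ B) :
    |∫ z, ψ z * f z| ≤ M * B * volume.real (closedBall (0 : En n) 1) := by
  have h : ∫ z in closedBall (0 : En n) 1, ψ z * f z = ∫ z, ψ z * f z :=
    setIntegral_eq_integral_of_forall_compl_eq_zero fun z hz => by
      rw [hψ0 z (by simpa using hz), zero_mul]
  rw [← h, ← Real.norm_eq_abs]
  refine norm_setIntegral_le_of_norm_le_const measure_closedBall_lt_top fun z _ => ?_
  rw [Real.norm_eq_abs, abs_mul]
  exact mul_le_mul (hψ z) (hf z) (abs_nonneg _) ((abs_nonneg _).trans (hψ z))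

lemma density_smoothKernel : SmoothKernel 1 (density n) :=
  ⟨density_contDiff, fun _ hy => density_eq_zero hy.le⟩

lemma mul_avg_dirDeriv {g : En n → ℝ} {L : ℝ≥0} (hg : LipschitzWith L g) (r : ℝ) (x e : En n) :
    r * avg r (fun y => fderiv ℝ g y e) x = -∫ z, fderiv ℝ (density n) z e * g (x + r • z) := by
  rw [← integral_mul_fderiv_affine hg (density_contDiff.of_le (by exact_mod_cast le_top))
    density_hasCompactSupport, avg, ← integral_const_mul]
  congr 1; ext z; ring

lemma sq_mul_avg_dirDeriv {g : En n → ℝ} {L L' : ℝ≥0} (hg : LipschitzWith L g) {e j : En n}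
    (hgj : LipschitzWith L' fun y => fderiv ℝ g y j) (r : ℝ) (x : En n) :
    r ^ 2 * avg r (fun y => fderiv ℝ (fun y => fderiv ℝ g y j) y e) x =
      ∫ z, fderiv ℝ (fun z => fderiv ℝ (density n) z e) z j * g (x + r • z) := by
  have hk : SmoothKernel 1 fun z => fderiv ℝ (density n) z e := density_smoothKernel.dirDeriv e
  have h := integral_mul_fderiv_affine hg (hk.1.of_le (by exact_mod_cast le_top))
    hk.hasCompactSupport x j (r := r)
  rw [pow_two, mul_assoc, mul_avg_dirDeriv hgj, mul_neg, ← integral_const_mul, ← neg_inj, neg_neg,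
    ← h]
  congr 1; ext z; ring

/-- Averages of first and second derivatives of bounded functions at definite scales. -/
lemma exists_avg_dirDeriv_le (n : ℕ) : ∃ D : ℝ, 0 ≤ D ∧ ∀ (g : En n → ℝ) (B : ℝ) (L : ℝ≥0),
    (∀ x, |g x| ≤ B) → LipschitzWith L g → ∀ (r : ℝ) (x : En n) (j : En n), 0 < r → ‖j‖ ≤ 1 →
      r * |avg r (fun y => fderiv ℝ g y j) x| ≤ D * B ∧
      ∀ (e : En n) (L' : ℝ≥0), ‖e‖ ≤ 1 → LipschitzWith L' (fun y => fderiv ℝ g y j) →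
        r ^ 2 * |avg r (fun y => fderiv ℝ (fun y => fderiv ℝ g y j) y e) x| ≤ D * B := by
  have hd : ContDiff ℝ 2 (density n) := contDiff_infty.1 density_contDiff 2
  obtain ⟨M, hM⟩ := exists_c2BddBy hd density_hasCompactSupport
  have hM0 : 0 ≤ M := (abs_nonneg _).trans (hM 0).1
  refine ⟨M * volume.real (closedBall (0 : En n) 1), by positivity,
    fun g B L hB hg r x j hr hj => ⟨?_, fun e L' he hL' => ?_⟩⟩
  · rw [← abs_of_pos hr, ← abs_mul, abs_of_pos hr, mul_avg_dirDeriv hg, abs_neg, mul_right_comm]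
    refine abs_integral_mul_le_of_support (fun z => ?_)
      (density_smoothKernel.dirDeriv j).2 (fun z => hB _)
    exact ((fderiv ℝ (density n) z).le_of_opNorm_le (hM z).2.1 j).trans
      (mul_le_of_le_one_right hM0 hj)
  · have hr2 : 0 < r ^ 2 := by positivity
    rw [← abs_of_pos hr2, ← abs_mul, sq_mul_avg_dirDeriv hg hL', mul_right_comm]
    refine abs_integral_mul_le_of_support (fun z => ?_)
      ((density_smoothKernel.dirDeriv e).dirDeriv j).2 (fun z => hB _)
    have hl : LipschitzWith (Real.toNNReal M) fun z => fderiv ℝ (density n) z e := by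
      refine LipschitzWith.of_dist_le_mul fun y y' => ?_
      rw [dist_eq_norm, dist_eq_norm, Real.coe_toNNReal _ hM0, ← sub_apply]
      exact ((fderiv ℝ (density n) y - fderiv ℝ (density n) y').le_of_opNorm_le
        (c2BddBy_fderiv_lipschitz hd hM y y') e).trans
          (mul_le_of_le_one_right (by positivity) he)
    have h1 := norm_fderiv_le_of_lipschitz ℝ hl (x₀ := z)
    rw [Real.coe_toNNReal _ hM0] at h1
    exact ((fderiv ℝ (fun z => fderiv ℝ (density n) z e) z).le_of_opNorm_le h1 j).trans
      (mul_le_of_le_one_right hM0 hj)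

lemma abs_avg_le {f : En n → ℝ} {B : ℝ} (hB : ∀ x, |f x| ≤ B) (r : ℝ) (x : En n) :
    |avg r f x| ≤ B := by
  have h  := BddMeas.abs_integral_mul_le (f := fun z => f (x + r • z)) (fun z => hB _) density_integrable
  have h1 : ∫ z, |density n z| = 1 := by
    rw [← density_integral (n := n)]; congr 1; ext z; exact abs_of_nonneg (density_nonneg z)
  rwa [h1, one_mul] at h

/-- Uniform interior bounds for the second and third derivatives of mollified solutions. -/
lemma exists_mollify_bounds (hn : 0 < n) (x₀ : En n) {ρ : ℝ} (hρ : 0 < ρ) (L : ℝ≥0) :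
    ∃ K : ℝ, 0 ≤ K ∧ ∀ (s : ℝ), s ∈ Ioo (0 : ℝ) 1 → ∀ (u ψ : En n → ℝ) (ε : ℝ), BddMeas u →
      LipschitzWith L u → IsWeakSHarmonicInB1 n s u → SmoothKernel ε ψ → ∫ y, |ψ y| ≤ 1 →
      ‖x₀‖ + ρ + ε < 1 → ∀ i j e : En n, ‖i‖ ≤ 1 → ‖j‖ ≤ 1 → ‖e‖ ≤ 1 →
      ∀ x ∈ closedBall x₀ (ρ / 4),
        |mollify (fun y => fderiv ℝ (fun y => fderiv ℝ ψ y i) y j) u x| ≤ K ∧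
        |mollify (fun y => fderiv ℝ (fun y => fderiv ℝ (fun y => fderiv ℝ ψ y i) y j) y e) u x|
          ≤ K := by
  obtain ⟨D, hD0, hD⟩ := exists_avg_dirDeriv_le n
  obtain ⟨K₁, hK₁0, hK₁⟩ := exists_interior_estimate x₀ hρ
  obtain ⟨K₂, hK₂0, hK₂⟩ := exists_interior_estimate x₀ (half_pos hρ)
  have hDL : 0 ≤ D * L := by positivity
  set T₁ : ℝ := L + 4 / ρ * (D * L) with hT₁
  set A₂ : ℝ := K₁ * (L + T₁) with hA₂
  set T₂ : ℝ := 8 / ρ * (D * L) + (8 / ρ) ^ 2 * (D * L) with hT₂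
  have hT₁0 : 0 ≤ T₁ := by positivity
  have hA₂0 : 0 ≤ A₂ := by positivity
  have hT₂0 : 0 ≤ T₂ := by positivity
  have hdiv : ∀ {a r c X : ℝ}, 0 < c → c < r → r * |a| ≤ X → 0 ≤ X → |a| ≤ 1 / c * X := by
    intro a r c X hc hcr h hX
    have h1 : c * |a| ≤ X := (mul_le_mul_of_nonneg_right hcr.le (abs_nonneg a)).trans h
    rw [one_div, inv_mul_eq_div, le_div_iff₀ hc, mul_comm]; exact h1
  refine ⟨A₂ + K₂ * (A₂ + T₂), by positivity, fun s hs u ψ ε hub hu hw hψ hψ1 hε i j e hi hj he => ?_⟩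
  have hψi := hψ.dirDeriv i
  have hψij := hψi.dirDeriv j
  have hψije := hψij.dirDeriv e
  set g₁ := mollify (fun y => fderiv ℝ ψ y i) u with hg₁
  have e₁ : (fun y => fderiv ℝ g₁ y j) =
      mollify (fun y => fderiv ℝ (fun y => fderiv ℝ ψ y i) y j) u :=
    funext fun y => fderiv_mollify hu hψi y j
  set g₂ := mollify (fun y => fderiv ℝ (fun y => fderiv ℝ ψ y i) y j) u with hg₂
  have e₂ : (fun y => fderiv ℝ g₂ y e) = mollify (fun y => fderiv ℝ
      (fun y => fderiv ℝ (fun y => fderiv ℝ ψ y i) y j) y e) u :=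
    funext fun y => fderiv_mollify hu hψij y e
  set g₃ := mollify (fun y => fderiv ℝ
      (fun y => fderiv ℝ (fun y => fderiv ℝ ψ y i) y j) y e) u with hg₃
  have hL₁ := lipschitzWith_mollify hub hu hψi.integrable
  have hL₂ := lipschitzWith_mollify hub hu hψij.integrable
  have hg₁L : ∀ y, |g₁ y| ≤ L := by
    intro y
    have hl := lipschitzWith_mollify hub hu hψ.integrable
    have h1 := norm_fderiv_le_of_lipschitz ℝ hl (x₀ := y)
    rw [NNReal.coe_mul, Real.coe_toNNReal _ (integral_nonneg fun _ => abs_nonneg _)] at h1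
    have h2 : ‖fderiv ℝ (mollify ψ u) y‖ ≤ L :=
      h1.trans (mul_le_of_le_one_left L.coe_nonneg hψ1)
    rw [hg₁, ← fderiv_mollify hu hψ]
    exact ((fderiv ℝ (mollify ψ u) y).le_of_opNorm_le h2 i).trans
      (mul_le_of_le_one_right L.coe_nonneg hi)
  have hin : ∀ y ∈ closedBall x₀ ρ, ‖y‖ + ε < 1 := by
    intro y hy
    rw [mem_closedBall, dist_eq_norm] at hy
    have := norm_add_le (y - x₀) x₀
    rw [sub_add_cancel] at this
    linarith
  have b₁ : ∀ x ∈ closedBall x₀ (ρ / 2), |g₂ x| ≤ A₂ := by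
    intro x hx
    have h := hK₁ s hs g₁ _ j L T₁ ((contDiff_mollify hu hψi).of_le (by exact_mod_cast le_top))
      (bddMeas_mollify hub hu hψi) hL₁ hj ?_ x hx
    · rw [← e₁]; exact h
    · intro y hy
      rw [e₁]
      refine ⟨tame_mollify hub hu hψi y, tame_mollify hub hu hψij y,
        avgLap_mollify_eq_zero hn hs hub hu hw hψi (hin y hy),
        avgLap_mollify_eq_zero hn hs hub hu hw hψij (hin y hy), hg₁L y, fun r hr => ⟨?_, ?_⟩⟩
      · refine (abs_avg_le hg₁L r y).trans ?_
        rw [hT₁]; exact le_add_of_nonneg_right (by positivity)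
      · have hr0 : 0 < r := by linarith [div_pos hρ four_pos]
        have h1 := (hD g₁ L _ hg₁L hL₁ r y j hr0 hj).1
        rw [e₁] at h1
        have h2 := hdiv (c := ρ / 4) (by positivity) hr h1 hDL
        rw [one_div_div] at h2
        rw [hT₁]; linarith [L.coe_nonneg]
  have hsub : closedBall x₀ (ρ / 2) ⊆ closedBall x₀ ρ := closedBall_subset_closedBall (by linarith)
  intro x hx
  refine ⟨?_, ?_⟩
  · have := b₁ x (closedBall_subset_closedBall (by linarith) hx)
    have : 0 ≤ K₂ * (A₂ + T₂) := by positivity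
    linarith
  · have h := hK₂ s hs g₂ _ e A₂ T₂ ((contDiff_mollify hu hψij).of_le (by exact_mod_cast le_top))
      (bddMeas_mollify hub hu hψij) hL₂ he ?_ x
        (by rwa [show ρ / 2 / 2 = ρ / 4 by ring])
    · rw [← e₂]; exact h.trans (le_add_of_nonneg_left hA₂0)
    · intro y hy
      rw [e₂]
      refine ⟨tame_mollify hub hu hψij y, tame_mollify hub hu hψije y,
        avgLap_mollify_eq_zero hn hs hub hu hw hψij (hin y (hsub hy)),
        avgLap_mollify_eq_zero hn hs hub hu hw hψije (hin y (hsub hy)), b₁ y hy,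
        fun r hr => ?_⟩
      have hr8 : ρ / 8 < r := by linarith
      have hr0 : 0 < r := by linarith [div_pos hρ (by norm_num : (0 : ℝ) < 8)]
      have hDg := hD g₁ L _ hg₁L hL₁ r y j hr0 hj
      have h1 := hDg.1
      have h2 := hDg.2 e _ he (by rw [e₁]; exact hL₂)
      simp only [e₁] at h1 h2
      rw [e₂] at h2
      have h3 := hdiv (c := ρ / 8) (by positivity) hr8 h1 hDL
      have h4 := hdiv (c := (ρ / 8) ^ 2) (by positivity)
        (pow_lt_pow_left₀ hr8 (by positivity) two_ne_zero) h2 hDL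
      rw [one_div_div] at h3
      rw [one_div, ← inv_pow, inv_div] at h4
      have h5 : 0 ≤ 8 / ρ * (D * L) := by positivity
      have h6 : 0 ≤ (8 / ρ) ^ 2 * (D * L) := by positivity
      exact ⟨by rw [hT₂]; linarith, by rw [hT₂]; linarith⟩

lemma abs_sub_le_of_dirDeriv_le {f : En n → ℝ} {s : Set (En n)} {K : ℝ} (hs : Convex ℝ s)
    (hK0 : 0 ≤ K) (hf : Differentiable ℝ f)
    (hK : ∀ y ∈ s, ∀ e : En n, ‖e‖ ≤ 1 → |fderiv ℝ f y e| ≤ K) {y y' : En n} (hy : y ∈ s)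
    (hy' : y' ∈ s) : |f y - f y'| ≤ K * ‖y - y'‖ :=
  hs.norm_image_sub_le_of_norm_fderiv_le (𝕜 := ℝ) (fun z _ => hf z)
    (fun z hz => ContinuousLinearMap.opNorm_le_of_unit_norm hK0 fun e he => hK z hz e he.le) hy' hy

/-- A radial mollifier at scale `ε`. -/
lemma exists_smoothKernel (n : ℕ) {ε : ℝ} (hε : 0 < ε) :
    ∃ ψ : En n → ℝ, SmoothKernel ε ψ ∧ (∀ y, 0 ≤ ψ y) ∧ ∫ y, ψ y = 1 := by
  let b : ContDiffBump (0 : En n) := ⟨ε / 2, ε, half_pos hε, half_lt_self hε⟩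
  refine ⟨b.normed volume, ⟨b.contDiff_normed, fun y hy => ?_⟩, b.nonneg_normed, b.integral_normed⟩
  have : y ∉ Function.support (b.normed volume) := by
    rw [b.support_normed_eq, mem_ball_zero_iff, not_lt]; exact hy.le
  exact Function.notMem_support.1 this

lemma abs_mollify_sub_self_le {u ψ : En n → ℝ} {L : ℝ≥0} {ε : ℝ} (hub : BddMeas u)
    (hu : LipschitzWith L u) (hψ : SmoothKernel ε ψ) (hψ0 : ∀ y, 0 ≤ ψ y) (hψ1 : ∫ y, ψ y = 1)
    (x : En n) : |mollify ψ u x - u x| ≤ L * ε := by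
  have h : mollify ψ u x - u x = ∫ y, ψ y * (u (x - y) - u x) := by
    have h1 : u x = ∫ y, ψ y * u x := by rw [integral_mul_const, hψ1, one_mul]
    conv_lhs => rw [h1]
    rw [mollify, ← integral_sub (hub.integrable_mul_sub hψ.integrable x)
      (hψ.integrable.mul_const _)]
    congr 1; ext y; ring
  have h2 : ∫ y, ψ y * (L * ε) = L * ε := by rw [integral_mul_const, hψ1, one_mul]
  rw [h, ← h2, ← Real.norm_eq_abs]
  refine norm_integral_le_of_norm_le (hψ.integrable.mul_const _) (Eventually.of_forall fun y => ?_)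
  rw [Real.norm_eq_abs, abs_mul, abs_of_nonneg (hψ0 y)]
  by_cases hy : ε < ‖y‖
  · simp [hψ.2 y hy]
  · refine mul_le_mul_of_nonneg_left ?_ (hψ0 y)
    have := hu.dist_le_mul (x - y) x
    rw [dist_eq_norm, dist_eq_norm, sub_sub_cancel_left, norm_neg] at this
    exact this.trans (mul_le_mul_of_nonneg_left (not_lt.1 hy) L.coe_nonneg)

/-- A sequence of smooth approximations of `u` with uniform `C³`-type bounds near `x₀`. -/
structure Approx (s : ℝ) (u : En n → ℝ) (x₀ : En n) (f : ℕ → En n → ℝ) (B δ K : ℝ) (L : ℝ≥0) :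
    Prop where
  contDiff : ∀ k, ContDiff ℝ (⊤ : ℕ∞) (f k)
  bound : ∀ k x, |f k x| ≤ B
  lipschitz : ∀ k, LipschitzWith L (f k)
  tendsto : ∀ x, Tendsto (fun k => f k x) atTop (nhds (u x))
  pos : 0 < δ
  nonneg : 0 ≤ K
  fderiv_sub_le : ∀ k, ∀ y ∈ ball x₀ δ, ∀ y' ∈ ball x₀ δ,
    ‖fderiv ℝ (f k) y - fderiv ℝ (f k) y'‖ ≤ K * ‖y - y'‖
  secDiff_le : ∀ k e z, ‖e‖ ≤ 1 → ‖z‖ < δ →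
    |secDiff (fun y => fderiv ℝ (f k) y e) x₀ z| ≤ K * ‖z‖ ^ 2
  avgLap_eq : ∀ k, avgLap s (f k) x₀ = 0
  avgLap_dirDeriv_eq : ∀ k e, avgLap s (fun y => fderiv ℝ (f k) y e) x₀ = 0

lemma exists_approx (hn : 0 < n) {s : ℝ} (hs : s ∈ Ioo (0 : ℝ) 1) {u : En n → ℝ} {L : ℝ≥0}
    (hub : BddMeas u) (hu : LipschitzWith L u) (hw : IsWeakSHarmonicInB1 n s u) {x₀ : En n}
    (hx₀ : ‖x₀‖ < 1) : ∃ f B δ K, Approx s u x₀ f B δ K L := by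
  set ρ : ℝ := (1 - ‖x₀‖) / 2 with hρ
  have hρ0 : 0 < ρ := by rw [hρ]; linarith
  obtain ⟨B, hB⟩ := hub.2
  obtain ⟨K, hK0, hK⟩ := exists_mollify_bounds hn x₀ hρ0 L
  set ε : ℕ → ℝ := fun k => ρ / 2 * (1 / ((k : ℝ) + 1)) with hε
  have hε0 : ∀ k, 0 < ε k := fun k => by positivity
  have hερ : ∀ k, ε k < ρ := fun k => by
    have h1 : (1 : ℝ) / ((k : ℝ) + 1) ≤ 1 := by
      rw [div_le_one (by positivity)]; linarith [(Nat.cast_nonneg k : (0 : ℝ) ≤ k)]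
    have := mul_le_of_le_one_right (half_pos hρ0).le h1
    simp only [hε]; linarith
  have hεt : Tendsto ε atTop (nhds 0) := by
    have := tendsto_one_div_add_atTop_nhds_zero_nat (𝕜 := ℝ).const_mul (ρ / 2)
    rwa [mul_zero] at this
  choose ψ hψ hψ0 hψ1 using fun k => exists_smoothKernel n (hε0 k)
  have hψa : ∀ k, ∫ y, |ψ k y| = 1 := fun k => by
    rw [← hψ1 k]; congr 1; ext y; exact abs_of_nonneg (hψ0 k y)
  have hin : ∀ k, ‖x₀‖ + ρ + ε k < 1 := fun k => by
    have := hερ k; rw [hρ] at this ⊢; linarith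
  have hin' : ∀ k, ‖x₀‖ + ε k < 1 := fun k => by linarith [hin k]
  have hest := fun k => hK s hs u (ψ k) (ε k) hub hu hw (hψ k) (hψa k).le (hin k)
  have hball : ∀ {y}, y ∈ ball x₀ (ρ / 4) → y ∈ closedBall x₀ (ρ / 4) := fun h =>
    ball_subset_closedBall h
  have e₁ : ∀ k i, (fun y => fderiv ℝ (mollify (ψ k) u) y i) =
      mollify (fun y => fderiv ℝ (ψ k) y i) u := fun k i =>
    funext fun y => fderiv_mollify hu (hψ k) y i
  refine ⟨fun k => mollify (ψ k) u, B, ρ / 4, K, ?_⟩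
  constructor
  · exact fun k => contDiff_mollify hu (hψ k)
  · intro k x
    have := abs_mollify_le hB (hψ k).integrable x
    rwa [hψa, one_mul] at this
  · intro k
    have := lipschitzWith_mollify hub hu (hψ k).integrable
    rwa [hψa, Real.toNNReal_one, one_mul] at this
  · intro x
    refine tendsto_iff_norm_sub_tendsto_zero.2 ?_
    refine squeeze_zero (fun _ => norm_nonneg _)
      (fun k => abs_mollify_sub_self_le hub hu (hψ k) (hψ0 k) (hψ1 k) x) ?_
    simpa using hεt.const_mul (L : ℝ)
  · positivity
  · exact hK0
  · intro k y hy y' hy'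
    refine ContinuousLinearMap.opNorm_le_of_unit_norm (by positivity) fun i hi => ?_
    rw [sub_apply, fderiv_mollify hu (hψ k), fderiv_mollify hu (hψ k)]
    refine abs_sub_le_of_dirDeriv_le (convex_ball x₀ (ρ / 4)) hK0
      ((contDiff_mollify hu ((hψ k).dirDeriv i)).differentiable (by simp))
      (fun z hz j hj => ?_) hy hy'
    rw [fderiv_mollify hu ((hψ k).dirDeriv i)]
    exact (hest k i j 0 hi.le hj (by simp) z (hball hz)).1
  · intro k i z hi hz
    have hψi := (hψ k).dirDeriv i
    simp only [e₁]
    refine abs_second_diff_le (δ := ρ / 4)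
      (fun y _ => (contDiff_mollify hu hψi).differentiable (by simp) y)
      (fun y hy y' hy' => ?_) hz
    refine ContinuousLinearMap.opNorm_le_of_unit_norm (by positivity) fun j hj => ?_
    rw [sub_apply, fderiv_mollify hu hψi, fderiv_mollify hu hψi]
    refine abs_sub_le_of_dirDeriv_le (convex_ball x₀ (ρ / 4)) hK0
      ((contDiff_mollify hu (hψi.dirDeriv j)).differentiable (by simp))
      (fun z hz e he => ?_) hy hy'
    rw [fderiv_mollify hu (hψi.dirDeriv j)]
    exact (hest k i j e hi hj.le he z (hball hz)).2
  · exact fun k => avgLap_mollify_eq_zero hn hs hub hu hw (hψ k) (hin' k)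
  · intro k e
    rw [e₁]
    exact avgLap_mollify_eq_zero hn hs hub hu hw ((hψ k).dirDeriv e) (hin' k)

namespace Approx

variable {s : ℝ} {u : En n → ℝ} {x₀ : En n} {f : ℕ → En n → ℝ} {B δ K : ℝ} {L : ℝ≥0}

lemma tendsto_fderiv (h : Approx s u x₀ f B δ K L) {y : En n} (hy : y ∈ ball x₀ δ) :
    Tendsto (fun k => fderiv ℝ (f k) y) atTop (nhds (fderiv ℝ u y)) := by
  refine tendsto_iff_ultrafilter _ _ _ |>.2 fun G hG => ?_
  have hmem : ∀ k, fderiv ℝ (f k) y ∈ closedBall (0 : En n →L[ℝ] ℝ) L := fun k => by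
    rw [mem_closedBall_zero_iff]; exact norm_fderiv_le_of_lipschitz ℝ (h.lipschitz k)
  have : ProperSpace (En n →L[ℝ] ℝ) := FiniteDimensional.proper ℝ _
  obtain ⟨A, -, hA⟩ := (isCompact_closedBall (0 : En n →L[ℝ] ℝ) L).ultrafilter_le_nhds'
    (G.map fun k => fderiv ℝ (f k) y) (Ultrafilter.mem_map.2 (univ_mem' hmem))
  have hA' : Tendsto (fun k => fderiv ℝ (f k) y) G (nhds A) := hA
  have hd : HasFDerivAt u A y := by
    have hgap : 0 < δ - dist y x₀ := sub_pos.2 (mem_ball.1 hy)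
    have hquad : ∀ z, ‖z‖ < δ - dist y x₀ → |u (y + z) - u y - A z| ≤ K * ‖z‖ * ‖z‖ := by
      intro z hz
      have hsub : closedBall y ‖z‖ ⊆ ball x₀ δ := fun w hw => by
        have := dist_triangle w y x₀
        rw [mem_closedBall] at hw
        rw [mem_ball]; linarith
      have hk : ∀ k, |f k (y + z) - f k y - fderiv ℝ (f k) y z| ≤ K * ‖z‖ * ‖z‖ := by
        intro k
        have := (convex_closedBall y ‖z‖).norm_image_sub_le_of_norm_fderiv_le' (𝕜 := ℝ)
          (f := f k) (φ := fderiv ℝ (f k) y) (C := K * ‖z‖) (x := y) (y := y + z)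
          (fun w _ => (h.contDiff k).differentiable (by simp) w)
          (fun w hw => (h.fderiv_sub_le k w (hsub hw) y hy).trans
            (mul_le_mul_of_nonneg_left (by rwa [mem_closedBall, dist_eq_norm] at hw) h.nonneg))
          (mem_closedBall_self (norm_nonneg z)) (by simp [dist_eq_norm])
        rwa [add_sub_cancel_left] at this
      have hz' : Tendsto (fun k => fderiv ℝ (f k) y z) G (nhds (A z)) :=
        ((ContinuousLinearMap.apply ℝ ℝ z).continuous.tendsto A).comp hA'
      exact le_of_tendsto ((((h.tendsto (y + z)).mono_left hG).sub
        ((h.tendsto y).mono_left hG)).sub hz').abs (Eventually.of_forall hk)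
    rw [hasFDerivAt_iff_isLittleO_nhds_zero]
    have hO : (fun z => u (y + z) - u y - A z) =O[nhds 0] fun z => ‖z‖ ^ 2 := by
      refine Asymptotics.IsBigO.of_bound K ?_
      filter_upwards [ball_mem_nhds (0 : En n) hgap] with z hz
      rw [norm_pow, norm_norm, pow_two, ← mul_assoc]
      exact hquad z (by simpa using hz)
    exact hO.trans_isLittleO ((Asymptotics.isLittleO_norm_pow_id one_lt_two))
  rw [hd.fderiv]
  exact hA'

lemma tendsto_dirDeriv (h : Approx s u x₀ f B δ K L) {y : En n} (hy : y ∈ ball x₀ δ) (e : En n) :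
    Tendsto (fun k => fderiv ℝ (f k) y e) atTop (nhds (fderiv ℝ u y e)) :=
  ((ContinuousLinearMap.apply ℝ ℝ e).continuous.tendsto _).comp (h.tendsto_fderiv hy)

lemma add_mem (h : Approx s u x₀ f B δ K L) {z : En n} (hz : ‖z‖ < δ) :
    x₀ ∈ ball x₀ δ ∧ x₀ + z ∈ ball x₀ δ ∧ x₀ - z ∈ ball x₀ δ :=
  ⟨mem_ball_self h.pos, by simpa [dist_eq_norm] using hz, by simpa [dist_eq_norm] using hz⟩

lemma secDiff_self_le (h : Approx s u x₀ f B δ K L) (k : ℕ) {z : En n} (hz : ‖z‖ < δ) :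
    |secDiff (f k) x₀ z| ≤ K * ‖z‖ ^ 2 :=
  abs_second_diff_le (fun y _ => (h.contDiff k).differentiable (by simp) y) (h.fderiv_sub_le k) hz

lemma tame (h : Approx s u x₀ f B δ K L) (hub : BddMeas u) (hu : LipschitzWith L u) :
    Tame u x₀ := by
  refine ⟨hub, δ, h.pos, max L K, le_max_of_le_right h.nonneg, fun z hz => ⟨?_, ?_⟩⟩
  · have := hu.dist_le_mul (x₀ + z) x₀
    rw [dist_eq_norm, dist_self_add_left] at this
    exact this.trans (mul_le_mul_of_nonneg_right (le_max_left _ _) (norm_nonneg z))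
  · have ht : Tendsto (fun k => secDiff (f k) x₀ z) atTop (nhds (secDiff u x₀ z)) :=
      (((h.tendsto x₀).const_mul 2).sub (h.tendsto (x₀ + z))).sub (h.tendsto (x₀ - z))
    refine (le_of_tendsto ht.abs (Eventually.of_forall fun k => h.secDiff_self_le k hz)).trans ?_
    exact mul_le_mul_of_nonneg_right (le_max_right _ _) (sq_nonneg _)

lemma tame_dirDeriv (h : Approx s u x₀ f B δ K L) (hu : LipschitzWith L u) {e : En n}
    (he : ‖e‖ ≤ 1) : Tame (fun y => fderiv ℝ u y e) x₀ := by
  refine ⟨bddMeas_dirDeriv hu e, δ, h.pos, K, h.nonneg, fun z hz => ?_⟩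
  obtain ⟨h0, h1, h2⟩ := h.add_mem hz
  have t0 := h.tendsto_dirDeriv h0 e
  have t1 := h.tendsto_dirDeriv h1 e
  have t2 := h.tendsto_dirDeriv h2 e
  refine ⟨le_of_tendsto (t1.sub t0).abs (Eventually.of_forall fun k => ?_),
    le_of_tendsto (((t0.const_mul 2).sub t1).sub t2).abs
      (Eventually.of_forall fun k => h.secDiff_le k e z he hz)⟩
  have h3 := (fderiv ℝ (f k) (x₀ + z) - fderiv ℝ (f k) x₀).le_of_opNorm_le
    (h.fderiv_sub_le k _ h1 _ h0) e
  rw [add_sub_cancel_left, sub_apply] at h3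
  exact h3.trans (mul_le_of_le_one_right (mul_nonneg h.nonneg (norm_nonneg z)) he)

end Approx

lemma tendsto_integral_mul_of_bounded {φ : En n → ℝ} (hφ : Integrable φ) {g : ℕ → En n → ℝ}
    {g' : En n → ℝ} {B : ℝ} (hm : ∀ k, Measurable (g k)) (hB : ∀ k x, |g k x| ≤ B)
    (ht : ∀ x, Tendsto (fun k => g k x) atTop (nhds (g' x))) :
    Tendsto (fun k => ∫ x, φ x * g k x) atTop (nhds (∫ x, φ x * g' x)) := by
  refine tendsto_integral_of_dominated_convergence (fun x => |φ x| * B)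
    (fun k => hφ.1.mul (hm k).aestronglyMeasurable) (hφ.abs.mul_const B)
    (fun k => Eventually.of_forall fun x => ?_) (Eventually.of_forall fun x => (ht x).const_mul _)
  rw [norm_mul]
  exact mul_le_mul_of_nonneg_left (hB k x) (norm_nonneg _)

/-- Vanishing of `avgLap` is preserved under suitable limits. -/
lemma avgLap_eq_zero_of_tendsto {s : ℝ} (hs : s ∈ Ioo (0 : ℝ) 1) {g : ℕ → En n → ℝ}
    {g' : En n → ℝ} {x : En n} {B δ K : ℝ} (hδ : 0 < δ) (hK0 : 0 ≤ K)
    (hm : ∀ k, Measurable (g k)) (hB : ∀ k x, |g k x| ≤ B)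
    (hK : ∀ k z, ‖z‖ < δ → |secDiff (g k) x z| ≤ K * ‖z‖ ^ 2)
    (ht : Tendsto (fun k => g k x) atTop (nhds (g' x)))
    (hr : ∀ r, 0 < r → Tendsto (fun k => avg r (g k) x) atTop (nhds (avg r g' x)))
    (h0 : ∀ k, avgLap s (g k) x = 0) : avgLap s g' x = 0 := by
  have hB0 : 0 ≤ B := (abs_nonneg _).trans (hB 0 x)
  set C := K + 4 * B + 4 * B / δ ^ 2 with hC
  have hlim : Tendsto (fun k => avgLap s (g k) x) atTop (nhds (avgLap s g' x)) := by
    refine tendsto_integral_of_dominated_convergence (fun r => C * min 1 (r ^ 2))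
      (fun k => (measurable_const.sub (measurable_avg (hm k) x)).aestronglyMeasurable)
      ((integrable_min_scaleMeasure hs).const_mul C)
      (fun k => Eventually.of_forall fun r => ?_) ?_
    · exact abs_sub_avg_le_min ⟨hm k, B, hB k⟩ (by positivity)
        (exists_secDiff_le hδ hK0 (hB k) (hK k))
    · filter_upwards [scaleMeasure_ae_pos s] with r h
      exact ht.sub (hr r h)
  simp only [h0] at hlim
  exact (tendsto_nhds_unique hlim tendsto_const_nhds)

/-- Interior regularity of weak solutions, together with the pointwise equations for the
solution and its first derivatives. -/
lemma tame_and_avgLap_eq_zero (hn : 0 < n) {s : ℝ} (hs : s ∈ Ioo (0 : ℝ) 1) {u : En n → ℝ}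
    {L : ℝ≥0} (hub : BddMeas u) (hu : LipschitzWith L u) (hw : IsWeakSHarmonicInB1 n s u)
    {x : En n} (hx : ‖x‖ < 1) :
    (Tame u x ∧ avgLap s u x = 0) ∧ ∀ e : En n, ‖e‖ ≤ 1 →
      Tame (fun y => fderiv ℝ u y e) x ∧ avgLap s (fun y => fderiv ℝ u y e) x = 0 := by
  obtain ⟨f, B, δ, K, h⟩ := exists_approx hn hs hub hu hw hx
  have hm : ∀ k, Measurable (f k) := fun k => (h.contDiff k).continuous.measurable
  refine ⟨⟨h.tame hub hu, ?_⟩, fun e he => ⟨h.tame_dirDeriv hu he, ?_⟩⟩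
  · refine avgLap_eq_zero_of_tendsto hs h.pos h.nonneg hm h.bound
      (fun k z hz => h.secDiff_self_le k hz) (h.tendsto x) (fun r _ => ?_) h.avgLap_eq
    exact tendsto_integral_mul_of_bounded density_integrable
      (fun k => (hm k).comp (by fun_prop)) (fun k z => h.bound k _) (fun z => h.tendsto _)
  · refine avgLap_eq_zero_of_tendsto (B := L) hs h.pos h.nonneg
      (fun k => (bddMeas_dirDeriv (h.lipschitz k) e).1) (fun k y => ?_)
      (fun k z hz => h.secDiff_le k e z he hz) (h.tendsto_dirDeriv (mem_ball_self h.pos) e)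
      (fun r hr => ?_) (fun k => h.avgLap_dirDeriv_eq k e)
    · exact ((fderiv ℝ (f k) y).le_of_opNorm_le
        (norm_fderiv_le_of_lipschitz ℝ (h.lipschitz k)) e).trans
          (mul_le_of_le_one_right L.coe_nonneg he)
    · have h1 : Tendsto (fun k => r * avg r (fun y => fderiv ℝ (f k) y e) x) atTop
          (nhds (r * avg r (fun y => fderiv ℝ u y e) x)) := by
        simp only [mul_avg_dirDeriv hu, mul_avg_dirDeriv (h.lipschitz _)]
        refine Tendsto.neg ?_
        exact tendsto_integral_mul_of_bounded (density_smoothKernel.dirDeriv e).integrable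
          (fun k => (hm k).comp (by fun_prop)) (fun k z => h.bound k _) (fun z => h.tendsto _)
      have h2 := h1.const_mul r⁻¹
      simpa only [inv_mul_cancel_left₀ hr.ne'] using h2

lemma norm_sq_eq_sum_dual (A : En n →L[ℝ] ℝ) :
    ‖A‖ ^ 2 = ∑ i, A (EuclideanSpace.basisFun (Fin n) ℝ i) ^ 2 := by
  set v := (InnerProductSpace.toDual ℝ (En n)).symm A with hv
  have h1 : ‖A‖ = ‖v‖ := ((InnerProductSpace.toDual ℝ (En n)).symm.norm_map A).symm
  rw [h1, ← (EuclideanSpace.basisFun (Fin n) ℝ).sum_sq_norm_inner_right v]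
  refine Finset.sum_congr rfl fun i _ => ?_
  rw [real_inner_comm, hv, InnerProductSpace.toDual_symm_apply, Real.norm_eq_abs, sq_abs]

lemma cns_nonneg (n : ℕ) {s : ℝ} (hs : s ∈ Ioo (0 : ℝ) 1) : 0 ≤ cns n s := by
  obtain ⟨h0, h1⟩ := hs
  have hn : (0 : ℝ) ≤ n := n.cast_nonneg
  have g1 : 0 < Real.Gamma ((n : ℝ) / 2 + s) := Real.Gamma_pos_of_pos (by positivity)
  have g2 : 0 < Real.Gamma (1 - s) := Real.Gamma_pos_of_pos (by linarith)
  rw [cns]; positivity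

/-- The principal value integral of a tame function is the absolutely convergent integral of its
second differences. -/
lemma fracLap_eq (hn : 0 < n) {s : ℝ} (hs : s ∈ Ioo (0 : ℝ) 1) {F : En n → ℝ} {x : En n}
    (hF : Tame F x) :
    fracLap n s F x = cns n s / 2 * ∫ z, secDiff F x z ∂jumpMeasure n s := by
  obtain ⟨C, hC0, hC⟩ := hF.exists_bound
  obtain ⟨hFb, -⟩ := hF
  obtain ⟨B, hB⟩ := hFb.2
  set c := cns n s
  set k : En n → ℝ := fun z => ‖z‖ ^ (-((n : ℝ) + 2 * s)) with hk
  have hk0 : ∀ z, 0 ≤ k z := fun z => Real.rpow_nonneg (norm_nonneg z) _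
  have hkm : Measurable k := by fun_prop
  have hki : Integrable fun z => k z * min 1 (‖z‖ ^ 2) := integrable_min_jump hn hs
  have hS : ∀ ε : ℝ, MeasurableSet {z : En n | ε ≤ ‖z‖} := fun ε =>
    measurableSet_le measurable_const measurable_norm
  have hval : ∀ ε : ℝ, 0 < ε →
      ∫ y in {y : En n | ε ≤ dist y x}, (F x - F y) * (c * ‖x - y‖ ^ (-((n : ℝ) + 2 * s))) =
        ∫ z, {z : En n | ε ≤ ‖z‖}.indicator (fun z => c / 2 * (k z * secDiff F x z)) z := by
    intro ε hε
    set H : En n → ℝ :=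
      {z : En n | ε ≤ ‖z‖}.indicator fun z => (F x - F (x + z)) * (c * k z) with hH
    have hHm : Measurable H := by
      refine Measurable.indicator ?_ (hS ε)
      have h1 : Measurable fun z => F (x + z) := hFb.1.comp (by fun_prop)
      exact (measurable_const.sub h1).mul (measurable_const.mul hkm)
    have hm0 : 0 < min 1 (ε ^ 2) := lt_min one_pos (by positivity)
    have hHi : Integrable H := by
      refine Integrable.mono' (hki.const_mul (2 * B * |c| / min 1 (ε ^ 2)))
        hHm.aestronglyMeasurable (Eventually.of_forall fun z => ?_)
      have hB0 : 0 ≤ B := (abs_nonneg _).trans (hB x)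
      have hmin : 0 ≤ min 1 (‖z‖ ^ 2) := le_min zero_le_one (sq_nonneg _)
      by_cases hz : z ∈ {z : En n | ε ≤ ‖z‖}
      · rw [hH, indicator_of_mem hz, Real.norm_eq_abs, abs_mul, abs_mul, abs_of_nonneg (hk0 z)]
        have h1 : |F x - F (x + z)| ≤ 2 * B :=
          (abs_sub _ _).trans (by linarith [hB x, hB (x + z)])
        have h2 : min 1 (ε ^ 2) ≤ min 1 (‖z‖ ^ 2) :=
          min_le_min_left _ (pow_le_pow_left₀ hε.le hz 2)
        have h3 : 1 ≤ min 1 (‖z‖ ^ 2) / min 1 (ε ^ 2) := (one_le_div hm0).2 h2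
        calc |F x - F (x + z)| * (|c| * k z) ≤ 2 * B * (|c| * k z) :=
              mul_le_mul_of_nonneg_right h1 (mul_nonneg (abs_nonneg c) (hk0 z))
          _ ≤ 2 * B * (|c| * k z) * (min 1 (‖z‖ ^ 2) / min 1 (ε ^ 2)) :=
              le_mul_of_one_le_right
                (mul_nonneg (by positivity) (mul_nonneg (abs_nonneg c) (hk0 z))) h3
          _ = _ := by ring
      · rw [hH, indicator_of_notMem hz, norm_zero]
        exact mul_nonneg (by positivity) (mul_nonneg (hk0 z) hmin)
    have hSx : MeasurableSet {y : En n | ε ≤ dist y x} :=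
      measurableSet_le measurable_const (measurable_id.dist measurable_const)
    have h1 : ∫ y in {y : En n | ε ≤ dist y x},
        (F x - F y) * (c * ‖x - y‖ ^ (-((n : ℝ) + 2 * s))) = ∫ y, H (y - x) := by
      rw [← integral_indicator hSx]
      congr 1; ext y
      simp only [hH, indicator, mem_ofPred_eq, dist_eq_norm, add_sub_cancel, hk, norm_sub_rev x y]
    have h2 : ∫ y, H (y - x) = ∫ z, H z := integral_sub_right_eq_self H x
    have h3 : ∫ z, H (-z) = ∫ z, H z := integral_neg_eq_self H volume
    have hHi' : Integrable fun z => H (-z) := hHi.comp_neg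
    have h4 : ∫ z, H z = ∫ z, (H z + H (-z)) / 2 := by
      rw [integral_div, integral_add hHi hHi', h3]; ring
    rw [h1, h2, h4]
    congr 1; ext z
    by_cases hz : ε ≤ ‖z‖
    · simp only [hH, indicator, mem_ofPred_eq, norm_neg, hz, if_true, secDiff, hk, ← sub_eq_add_neg]
      ring
    · simp [hH, indicator, hz]
  have hlim : Tendsto (fun ε : ℝ => ∫ z, {z : En n | ε ≤ ‖z‖}.indicator
      (fun z => c / 2 * (k z * secDiff F x z)) z) (nhdsWithin 0 (Ioi 0))
      (nhds (∫ z, c / 2 * (k z * secDiff F x z))) := by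
    have hm : Measurable fun z => c / 2 * (k z * secDiff F x z) :=
      measurable_const.mul (hkm.mul (measurable_secDiff hFb.1 x))
    refine tendsto_integral_filter_of_dominated_convergence
      (fun z => |c / 2| * C * (k z * min 1 (‖z‖ ^ 2)))
      (Eventually.of_forall fun ε => (hm.indicator (hS ε)).aestronglyMeasurable)
      (Eventually.of_forall fun ε => Eventually.of_forall fun z => ?_)
      (hki.const_mul _) (Eventually.of_forall fun z => ?_)
    · refine (norm_indicator_le_norm_self _ _).trans ?_
      rw [Real.norm_eq_abs, abs_mul, abs_mul, abs_of_nonneg (hk0 z)]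
      have := mul_le_mul_of_nonneg_left (mul_le_mul_of_nonneg_left (hC z) (hk0 z))
        (abs_nonneg (c / 2))
      linarith
    · rcases eq_or_ne z 0 with rfl | hz
      · have : secDiff F x 0 = 0 := by rw [secDiff, add_zero, sub_zero]; ring
        simp [indicator, this]
      · refine tendsto_const_nhds.congr' ?_
        filter_upwards [mem_nhdsWithin_of_mem_nhds (Iio_mem_nhds (norm_pos_iff.2 hz))] with ε hε
        have hε' : ε ≤ ‖z‖ := le_of_lt (mem_Iio.1 hε)
        have hmem : z ∈ {z : En n | ε ≤ ‖z‖} := hε'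
        exact (indicator_of_mem hmem fun z => c / 2 * (k z * secDiff F x z)).symm
  rw [integral_jumpMeasure, ← integral_const_mul]
  refine Tendsto.limUnder_eq (hlim.congr' ?_)
  filter_upwards [self_mem_nhdsWithin] with ε hε
  exact (hval ε hε).symm

lemma integral_secDiff_nonpos (hn : 0 < n) {s : ℝ} (hs : s ∈ Ioo (0 : ℝ) 1) {F : En n → ℝ}
    {x : En n} (hF : Tame F x) (h : avgLap s F x ≤ 0) :
    Integrable (secDiff F x) (jumpMeasure n s) ∧ ∫ z, secDiff F x z ∂jumpMeasure n s ≤ 0 := by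
  obtain ⟨C, -, hC⟩ := hF.exists_bound
  obtain ⟨κ, hκ, hl⟩ := layer_formula hn hs
  obtain ⟨hi, he⟩ := hl (secDiff F x) C (measurable_secDiff hF.1.1 x) hC
  refine ⟨hi, ?_⟩
  simp only [integral_density_mul_secDiff hF.1] at he
  rw [integral_const_mul] at he
  have h' : ∫ r, (F x - avg r F x) ∂scaleMeasure s ≤ 0 := h
  by_contra! hpos
  have := mul_pos hκ hpos
  linarith

lemma Tame.sum {ι : Type*} (t : Finset ι) {f : ι → En n → ℝ} {x : En n}
    (h : ∀ i ∈ t, Tame (f i) x) : Tame (fun y => ∑ i ∈ t, f i y) x := by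
  classical
  induction t using Finset.induction_on with
  | empty => simpa using Tame.const 0 x
  | insert i t hi ih =>
    simp only [Finset.sum_insert hi]
    exact (h i (Finset.mem_insert_self i t)).add
      (ih fun j hj => h j (Finset.mem_insert_of_mem hj))

/-- The key inequality for a single direction. -/
lemma tame_bernstein_and_avgLap_nonpos (hn : 0 < n) {s : ℝ} (hs : s ∈ Ioo (0 : ℝ) 1)
    {u η : En n → ℝ} {L : ℝ≥0} {M σ : ℝ} (hub : BddMeas u) (hu : LipschitzWith L u)
    (hw : IsWeakSHarmonicInB1 n s u) (hη : ContDiff ℝ 2 η) (hM : C2BddBy n η M)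
    (hσ : bernsteinConst n * M ^ 2 ≤ σ) {e : En n} (he : ‖e‖ ≤ 1) {x : En n} (hx : ‖x‖ < 1) :
    Tame (bernstein η u σ e) x ∧ avgLap s (bernstein η u σ e) x ≤ 0 := by
  obtain ⟨⟨tu, lu⟩, hv⟩ := tame_and_avgLap_eq_zero hn hs hub hu hw hx
  obtain ⟨tv, lv⟩ := hv e he
  have tη : Tame η x := Tame.of_fderiv_lipschitz (c2BddBy_bddMeas hη hM) one_pos
    (fun y _ => hη.differentiable (by simp) y)
    (fun y _ y' _ => c2BddBy_fderiv_lipschitz hη hM y y')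
  have tF : Tame (bernstein η u σ e) x := (tη.sq.mul tv.sq).add (tu.sq.const_mul σ)
  refine ⟨tF, ?_⟩
  have i1 := (tv.integrable_sub_avg hs).const_mul (2 * η x ^ 2 * fderiv ℝ u x e)
  have i2 := (tu.integrable_sub_avg hs).const_mul (2 * σ * u x)
  have h1 := integral_mono_ae (tF.integrable_sub_avg hs) (i1.add i2) (by
    filter_upwards [scaleMeasure_ae_pos s] with r hr
    exact bernstein_sub_avg_le hub hu hη hM he hσ hr x)
  have h2 := integral_add i1 i2
  rw [integral_const_mul, integral_const_mul] at h2
  have lv' : ∫ r, (fderiv ℝ u x e - avg r (fun y => fderiv ℝ u y e) x) ∂scaleMeasure s = 0 := lv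
  have lu' : ∫ r, (u x - avg r u x) ∂scaleMeasure s = 0 := lu
  rw [lv', lu', mul_zero, mul_zero, add_zero] at h2
  exact h1.trans h2.le

lemma fracLap_bernstein_nonpos (hn : 0 < n) {s : ℝ} (hs : s ∈ Ioo (0 : ℝ) 1)
    {u η : En n → ℝ} {L : ℝ≥0} {M σ : ℝ} (hub : BddMeas u) (hu : LipschitzWith L u)
    (hw : IsWeakSHarmonicInB1 n s u) (hη : ContDiff ℝ 2 η) (hM : C2BddBy n η M)
    (hσ : n * (bernsteinConst n * M ^ 2) ≤ σ) {x : En n} (hx : ‖x‖ < 1) :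
    fracLap n s (fun y => η y ^ 2 * ‖fderiv ℝ u y‖ ^ 2 + σ * u y ^ 2) x ≤ 0 := by
  have hn' : (0 : ℝ) < n := Nat.cast_pos.2 hn
  set b : Fin n → En n → ℝ :=
    fun i => bernstein η u (σ / n) (EuclideanSpace.basisFun (Fin n) ℝ i) with hb
  have hsum : (fun y => η y ^ 2 * ‖fderiv ℝ u y‖ ^ 2 + σ * u y ^ 2) = fun y => ∑ i, b i y := by
    ext y
    simp only [hb, bernstein, Finset.sum_add_distrib, Finset.sum_const, Finset.card_univ,
      Fintype.card_fin, nsmul_eq_mul, ← Finset.mul_sum, norm_sq_eq_sum_dual]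
    field_simp
  have hi := fun i => tame_bernstein_and_avgLap_nonpos (e := EuclideanSpace.basisFun (Fin n) ℝ i)
    hn hs hub hu hw hη hM (σ := σ / n) ((le_div_iff₀' hn').2 hσ)
    ((EuclideanSpace.basisFun (Fin n) ℝ).norm_eq_one i).le hx
  have hI := fun i => integral_secDiff_nonpos hn hs (hi i).1 (hi i).2
  rw [hsum, fracLap_eq hn hs (Tame.sum Finset.univ fun i _ => (hi i).1)]
  have hsec : (fun z => secDiff (fun y => ∑ i, b i y) x z) =
      fun z => ∑ i, secDiff (b i) x z := by
    ext z
    simp only [secDiff, Finset.sum_sub_distrib, Finset.mul_sum]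
  rw [hsec, integral_finsetSum _ fun i _ => (hI i).1]
  exact mul_nonpos_of_nonneg_of_nonpos (div_nonneg (cns_nonneg n hs) zero_le_two)
    (Finset.sum_nonpos fun i _ => (hI i).2)

end FracBernstein

/-- key inequality for `s`-harmonic functions.  If `u ∈ W^{1,∞}(ℝⁿ)` is a
weak solution of `(-Δ)^s u = 0` in `B₁` and `η ∈ C^∞ ∩ W^{2,∞}`, then there is
`σ₀ = σ₀(n, ‖η‖_{C²}) > 0` such that `(-Δ)^s (η²|∇u|² + σ u²) ≤ 0` in `B₁` for every
`σ ≥ σ₀`. -/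
theorem key_inequality_s_harmonic (n : ℕ) (hn : 0 < n) :
    ∃ σ₀ : ℝ → ℝ, (∀ M : ℝ, 0 < σ₀ M) ∧
      ∀ (s : ℝ), s ∈ Set.Ioo (0:ℝ) 1 →
      ∀ (η : En n → ℝ), ContDiff ℝ (⊤ : ℕ∞) η →
      ∀ (M : ℝ), C2BddBy n η M →
      ∀ (u : En n → ℝ),
        -- `u ∈ W^{1,∞}(ℝⁿ)`
        (∃ Mu : ℝ, ∀ x, |u x| ≤ Mu) → (∃ L : ℝ≥0, LipschitzWith L u) →
        IsWeakSHarmonicInB1 n s u →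
      ∀ (σ : ℝ), σ₀ M ≤ σ →
      ∀ x ∈ ball (0 : En n) 1,
        fracLap n s (fun y => (η y)^2 * ‖fderiv ℝ u y‖^2 + σ * (u y)^2) x ≤ 0 := by
  refine ⟨fun M => n * (FracBernstein.bernsteinConst n * M ^ 2) + 1, fun M => ?_,
    fun s hs η hη M hM u ⟨Mu, hMu⟩ ⟨L, hL⟩ hw σ hσ x hx => ?_⟩
  · have := FracBernstein.bernsteinConst_nonneg (n := n)
    positivity
  · exact FracBernstein.fracLap_bernstein_nonpos hn hs ⟨hL.continuous.measurable, Mu, hMu⟩ hL hw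
      (contDiff_infty.1 hη 2) hM (by linarith) (mem_ball_zero_iff.1 hx)
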